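/- arXiv:1605.03074 — 3 statements merged into one kernel-verified Lean document; each statement's English description precedes it below -/
import Mathlib

section
/- For every natural number n there exist integers w, x, y, z with n = w^2 + x^2 + y^2 + z^2 such that (2w + x)·(2w + x - y - 3z) = 0; consequently, for this representation (10w + 5x)^2 + (12y + 36z)^2 is a perfect square. -/
theorem exists_two_mul_add_mul_le {a : ℤ} (ha : 0 < a) (t : ℤ) :
    ∃ k : ℤ, 2 * (t + a * k) ≤ a ∧ -a ≤ 2 * (t + a * k) := by
  refine ⟨-((2 * t + a) / (2 * a)), ?_, ?_⟩ <;>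
  nlinarith [Int.mul_ediv_add_emod (2 * t + a) (2 * a),
    Int.emod_nonneg (2 * t + a) (by positivity : 2 * a ≠ 0),
    Int.emod_lt_of_pos (2 * t + a) (by positivity : 0 < 2 * a)]

/-- Lagrange reduction of a positive definite binary form `A y² + 2 B y z + C z²`. -/
theorem exists_unimodular_binary_le (A B C D : ℤ) (hA : 0 < A) (hD : 0 < D)
    (h : A * C - B ^ 2 = D) :
    ∃ p q r s : ℤ, p * s - q * r = 1 ∧ 0 < A * p ^ 2 + 2 * B * p * r + C * r ^ 2 ∧
      3 * (A * p ^ 2 + 2 * B * p * r + C * r ^ 2) ^ 2 ≤ 4 * D := by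
  induction hn : A.toNat using Nat.strong_induction_on generalizing A B C with
  | _ n ih =>
    subst hn
    obtain ⟨k, hk₁, hk₂⟩ := exists_two_mul_add_mul_le hA B
    set B' := B + A * k with hB'
    set C' := A * k ^ 2 + 2 * B * k + C with hC'
    have hdet : A * C' - B' ^ 2 = D := by rw [← h, hB', hC']; ring
    have hC'pos : 0 < C' := by
      by_contra! hneg
      nlinarith [sq_nonneg B']
    by_cases hlt : C' < A
    · obtain ⟨p, q, r, s, h₁, h₂, h₃⟩ := ih C'.toNat (by omega) C' (-B') A hC'pos
        (by rw [← hdet]; ring) rfl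
      refine ⟨k * p - r, k * q - s, p, q, by linear_combination h₁, ?_, ?_⟩
      · convert h₂ using 1; rw [hB', hC']; ring
      · convert h₃ using 3; rw [hB', hC']; ring
    · refine ⟨1, 0, 0, 1, by ring, by linarith, ?_⟩
      have : B' ^ 2 * 4 ≤ A ^ 2 := by nlinarith
      nlinarith

theorem lt_of_reduced {a b f : ℤ} (ha : 2 ≤ a) (hf : 4 * f ^ 2 ≤ a ^ 2)
    (h : 3 * (a * b - f ^ 2) ^ 2 ≤ 4 * a) : b < a := by
  by_contra! hge
  have h₁ : 3 * a ^ 2 ≤ 4 * (a * b - f ^ 2) := by nlinarith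
  have h₂ : (3 * a ^ 2) ^ 2 ≤ (4 * (a * b - f ^ 2)) ^ 2 := pow_le_pow_left₀ (by positivity) h₁ 2
  have h₃ : 27 * a ^ 3 ≤ 64 := by
    have : a * (27 * a ^ 3) ≤ a * 64 := by linarith
    exact le_of_mul_le_mul_left this (by linarith)
  have : 2 ^ 3 ≤ a ^ 3 := pow_le_pow_left₀ (by norm_num) ha 3
  linarith

/-- An integral positive definite ternary quadratic form of determinant one represents only
sums of three squares. -/
theorem exists_sum_three_squares_of_det_eq_one (a b c d e f : ℤ) (ha : 0 < a)
    (hab : 0 < a * b - f ^ 2)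
    (hdet : a * b * c + 2 * d * e * f - a * d ^ 2 - b * e ^ 2 - c * f ^ 2 = 1) (x y z : ℤ) :
    ∃ u v w : ℤ, a * x ^ 2 + b * y ^ 2 + c * z ^ 2 + 2 * d * y * z + 2 * e * x * z
      + 2 * f * x * y = u ^ 2 + v ^ 2 + w ^ 2 := by
  induction hn : a.toNat using Nat.strong_induction_on generalizing a b c d e f x y z with
  | _ n ih =>
    subst hn
    obtain ⟨p, q, r, s, hu, hpos, hle⟩ := exists_unimodular_binary_le (a * b - f ^ 2)
      (a * d - e * f) (a * c - e ^ 2) a hab ha (by linear_combination a * hdet)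
    obtain ⟨k, hk₁, hk₂⟩ := exists_two_mul_add_mul_le ha (f * p + e * r)
    obtain ⟨l, hl₁, hl₂⟩ := exists_two_mul_add_mul_le ha (f * q + e * s)
    obtain ⟨f', hf'⟩ : ∃ t, t = f * p + e * r + a * k := ⟨_, rfl⟩
    obtain ⟨e', he'⟩ : ∃ t, t = f * q + e * s + a * l := ⟨_, rfl⟩
    obtain ⟨b', hb'⟩ : ∃ t, t = a * k ^ 2 + b * p ^ 2 + c * r ^ 2 + 2 * d * p * r
      + 2 * e * k * r + 2 * f * k * p := ⟨_, rfl⟩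
    obtain ⟨c', hc'⟩ : ∃ t, t = a * l ^ 2 + b * q ^ 2 + c * s ^ 2 + 2 * d * q * s
      + 2 * e * l * s + 2 * f * l * q := ⟨_, rfl⟩
    obtain ⟨d', hd'⟩ : ∃ t, t = a * k * l + b * p * q + c * r * s + d * (p * s + q * r)
      + e * (k * s + l * r) + f * (k * q + l * p) := ⟨_, rfl⟩
    rw [← hf'] at hk₁ hk₂
    rw [← he'] at hl₁ hl₂
    have hG : a * b' - f' ^ 2 = (a * b - f ^ 2) * p ^ 2 + 2 * (a * d - e * f) * p * r
        + (a * c - e ^ 2) * r ^ 2 := by rw [hb', hf']; ring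
    rw [← hG] at hpos hle
    have hdet' : a * b' * c' + 2 * d' * e' * f' - a * d' ^ 2 - b' * e' ^ 2 - c' * f' ^ 2 = 1 := by
      have : a * b' * c' + 2 * d' * e' * f' - a * d' ^ 2 - b' * e' ^ 2 - c' * f' ^ 2 =
          (p * s - q * r) ^ 2 *
          (a * b * c + 2 * d * e * f - a * d ^ 2 - b * e ^ 2 - c * f ^ 2) := by
        rw [hb', hc', hd', he', hf']; ring
      rw [this, hu, hdet]; norm_num
    clear hG
    obtain ⟨y', z', hy, hz⟩ : ∃ y' z', y = p * y' + q * z' ∧ z = r * y' + s * z' :=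
      ⟨s * y - q * z, p * z - r * y, by linear_combination -y * hu, by linear_combination -z * hu⟩
    obtain ⟨x', hx⟩ : ∃ x', x = x' + k * y' + l * z' := ⟨x - k * y' - l * z', by ring⟩
    have hQ : a * x ^ 2 + b * y ^ 2 + c * z ^ 2 + 2 * d * y * z + 2 * e * x * z
      + 2 * f * x * y = a * x' ^ 2 + b' * y' ^ 2 + c' * z' ^ 2 + 2 * d' * y' * z'
      + 2 * e' * x' * z' + 2 * f' * x' * y' := by
      rw [hb', hc', hd', he', hf', hx, hy, hz]; ring
    rw [hQ]
    have hf4 : 4 * f' ^ 2 ≤ a ^ 2 := by nlinarith only [hk₁, hk₂]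
    obtain rfl | ha2 : a = 1 ∨ 2 ≤ a := by omega
    · obtain rfl : f' = 0 := by omega
      obtain rfl : e' = 0 := by omega
      have hsq : 3 * b' ^ 2 ≤ 4 := by simpa using hle
      have hb'le : b' ≤ 1 := by nlinarith only [hsq]
      obtain rfl : b' = 1 := by omega
      exact ⟨x', y' + d' * z', z', by linear_combination z' ^ 2 * hdet'⟩
    · have hb'pos : 0 < b' := by
        by_contra! hneg
        nlinarith only [sq_nonneg f', hneg, hpos, ha]
      have hlt : b' < a := by
        exact lt_of_reduced ha2 hf4 hle
      obtain ⟨u, v, w, huvw⟩ := ih b'.toNat (by omega) b' a c' e' d' f' hb'pos (by linarith)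
        (by linear_combination hdet') y' x' z' rfl
      exact ⟨u, v, w, by linear_combination huvw⟩

theorem exists_sum_three_squares_of_dvd {N d s : ℤ} (hd : 0 < d) (hN : 1 < d * N)
    (h : d * N - 1 ∣ s ^ 2 + d) : ∃ u v w : ℤ, N = u ^ 2 + v ^ 2 + w ^ 2 := by
  obtain ⟨a, ha⟩ := h
  have hapos : 0 < a := by
    by_contra! hneg
    nlinarith [sq_nonneg s]
  obtain ⟨u, v, w, h⟩ := exists_sum_three_squares_of_det_eq_one a (d * N - 1) N 0 1 s hapos
    (by linarith) (by linear_combination (-N) * ha) 0 0 1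
  exact ⟨u, v, w, by linear_combination h⟩

theorem exists_sq_add_dvd_of_jacobiSym {p d : ℕ} [Fact p.Prime] (h : jacobiSym (-d) p = 1) :
    ∃ s : ℤ, (p : ℤ) ∣ s ^ 2 + d := by
  obtain ⟨t, ht⟩ := ZMod.isSquare_of_jacobiSym_eq_one h
  obtain ⟨s, rfl⟩ := ZMod.intCast_surjective t
  refine ⟨s, (ZMod.intCast_zmod_eq_zero_iff_dvd _ p).1 ?_⟩
  push_cast at ht ⊢
  linear_combination -ht

theorem exists_sum_three_squares_of_mod_four_eq_two {N : ℕ} (hN : N % 4 = 2) :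
    ∃ u v w : ℤ, (N : ℤ) = u ^ 2 + v ^ 2 + w ^ 2 := by
  have hc : Nat.Coprime (N - 1) (4 * N) := by
    refine Nat.Coprime.mul_right ?_ ?_
    · exact Nat.Coprime.pow_right 2 (Nat.coprime_two_right.2 (Nat.odd_iff.2 (by omega)))
    · exact (Nat.coprime_self_sub_left (by omega)).2 (Nat.coprime_one_left N)
  obtain ⟨p, hp, hpp, hpm⟩ := Nat.forall_exists_prime_gt_and_modEq (N - 1) (by omega) hc
  obtain ⟨v, hv⟩ := (Nat.modEq_iff_dvd' hp.le).1 hpm.symm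
  have hpd : p + 1 = (4 * v + 1) * N := by
    have : p + 1 = 4 * N * v + N := by omega
    linarith
  have hp4 : p % 4 = 1 := by
    have : p + 1 = 4 * (N * v) + N := by linarith
    omega
  have : Fact p.Prime := ⟨hpp⟩
  have hdodd : Odd (4 * v + 1) := ⟨2 * v, by ring⟩
  have hpdz : (p : ℤ) + 1 = ((4 * v + 1 : ℕ) : ℤ) * N := by exact_mod_cast hpd
  have hJ : jacobiSym (-(4 * v + 1 : ℕ)) p = 1 := by
    rw [jacobiSym.neg _ (Nat.odd_iff.2 (by omega)), ZMod.χ₄_nat_one_mod_four hp4, one_mul,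
      jacobiSym.quadratic_reciprocity_one_mod_four' hdodd hp4,
      jacobiSym.mod_left' (a₂ := -1), jacobiSym.at_neg_one hdodd,
      ZMod.χ₄_nat_one_mod_four (by omega)]
    exact Int.ModEq.symm (Int.modEq_iff_dvd.2 ⟨N, by linarith⟩)
  obtain ⟨s, hs⟩ := exists_sq_add_dvd_of_jacobiSym hJ
  have := hpp.two_le
  refine exists_sum_three_squares_of_dvd (d := (4 * v + 1 : ℕ)) (s := s) (by positivity)
    (by linarith) ?_
  rwa [← hpdz, add_sub_cancel_right]

theorem exists_sum_three_squares_of_mod_four_eq_one {N : ℕ} (hN : N % 4 = 1) :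
    ∃ u v w : ℤ, (N : ℤ) = u ^ 2 + v ^ 2 + w ^ 2 := by
  obtain ⟨m, hm⟩ : ∃ m, 2 * m + 1 = 3 * N := ⟨(3 * N - 1) / 2, by omega⟩
  have hc : Nat.Coprime m (4 * N) := by
    refine Nat.Coprime.mul_right ?_ ?_
    · exact Nat.Coprime.pow_right 2 (Nat.coprime_two_right.2 (Nat.odd_iff.2 (by omega)))
    · rw [← Nat.isCoprime_iff_coprime]
      exact ⟨-2, 3, by zify at hm; linarith⟩
  obtain ⟨p, hp, hpp, hpm⟩ := Nat.forall_exists_prime_gt_and_modEq m (by omega) hc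
  obtain ⟨v, hv⟩ := (Nat.modEq_iff_dvd' hp.le).1 hpm.symm
  have hpd : 2 * p + 1 = (8 * v + 3) * N := by
    have : p = 4 * N * v + m := by omega
    linarith
  have hpN : 2 * p + 1 = 8 * (N * v) + 3 * N := by linarith
  have : Fact p.Prime := ⟨hpp⟩
  have hdodd : Odd (8 * v + 3) := ⟨4 * v + 1, by ring⟩
  have hpodd : Odd p := Nat.odd_iff.2 (by omega)
  have hpdz : 2 * (p : ℤ) + 1 = ((8 * v + 3 : ℕ) : ℤ) * N := by exact_mod_cast hpd
  have hrec : jacobiSym (-(8 * v + 3 : ℕ)) p = jacobiSym p (8 * v + 3) := by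
    rw [jacobiSym.neg _ hpodd]
    obtain hp4 | hp4 : p % 4 = 1 ∨ p % 4 = 3 := by omega
    · rw [ZMod.χ₄_nat_one_mod_four hp4, one_mul,
        jacobiSym.quadratic_reciprocity_one_mod_four' hdodd hp4]
    · rw [ZMod.χ₄_nat_three_mod_four hp4,
        jacobiSym.quadratic_reciprocity_three_mod_four (by omega) hp4]
      ring
  have htwo : jacobiSym (-2) (8 * v + 3) = 1 := by
    rw [jacobiSym.at_neg_two hdodd, ZMod.χ₈'_nat_eq_if_mod_eight]
    simp; omega
  have hJ : jacobiSym (-(8 * v + 3 : ℕ)) p = 1 := by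
    have hmul : jacobiSym (-2) (8 * v + 3) * jacobiSym p (8 * v + 3) = 1 := by
      rw [← jacobiSym.mul_left, jacobiSym.mod_left' (a₂ := 1), jacobiSym.one_left]
      exact (Int.modEq_iff_dvd.2 ⟨N, by linarith⟩ : -2 * (p : ℤ) ≡ 1 [ZMOD (8 * v + 3 : ℕ)])
    rwa [htwo, one_mul, ← hrec] at hmul
  obtain ⟨s, hs⟩ := exists_sq_add_dvd_of_jacobiSym hJ
  have := hpp.two_le
  obtain ⟨t, ht, hodd⟩ : ∃ t : ℤ, (p : ℤ) ∣ t ^ 2 + (8 * v + 3 : ℕ) ∧ Odd t := by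
    obtain h | h := Int.even_or_odd s
    · refine ⟨s + p, ?_, h.add_odd (by exact_mod_cast hpodd)⟩
      have := hs.add (dvd_mul_right (p : ℤ) (2 * s + p))
      ring_nf at this ⊢
      exact this
    · exact ⟨s, hs, h⟩
  refine exists_sum_three_squares_of_dvd (d := (8 * v + 3 : ℕ)) (s := t) (by positivity)
    (by linarith) ?_
  rw [← hpdz, add_sub_cancel_right]
  refine IsCoprime.mul_dvd ?_ ?_ ht
  · exact_mod_cast Nat.isCoprime_iff_coprime.2 (Nat.coprime_two_left.2 hpodd)
  · refine even_iff_two_dvd.1 (hodd.pow.add_odd ?_)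
    exact_mod_cast hdodd

theorem five_dvd_of_five_dvd_sum_three_squares {p q r : ℤ} (h : 5 ∣ p ^ 2 + q ^ 2 + r ^ 2) :
    5 ∣ p ∨ 5 ∣ q ∨ 5 ∣ r := by
  have key : ∀ p q r : ZMod 5, p ^ 2 + q ^ 2 + r ^ 2 = 0 → p = 0 ∨ q = 0 ∨ r = 0 := by decide
  have := key p q r (by exact_mod_cast (ZMod.intCast_zmod_eq_zero_iff_dvd _ 5).2 h)
  simpa only [ZMod.intCast_zmod_eq_zero_iff_dvd, Nat.cast_ofNat] using this

theorem five_dvd_sub_or_add {p q : ℤ} (h : 5 ∣ p ^ 2 + q ^ 2) :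
    5 ∣ p - 2 * q ∨ 5 ∣ p + 2 * q := by
  refine (Int.prime_iff_natAbs_prime.2 (by norm_num)).dvd_or_dvd ?_
  convert h.sub (dvd_mul_right 5 (q ^ 2)) using 1
  ring

theorem three_dvd_sub_or_add {p q r : ℤ} (h : 3 ∣ p ^ 2 + q ^ 2 + r ^ 2) :
    (3 ∣ p - q ∨ 3 ∣ p + q) ∧ (3 ∣ p - r ∨ 3 ∣ p + r) := by
  have key : ∀ p q r : ZMod 3, p ^ 2 + q ^ 2 + r ^ 2 = 0 →
      (p - q = 0 ∨ p + q = 0) ∧ (p - r = 0 ∨ p + r = 0) := by decide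
  have := key p q r (by exact_mod_cast (ZMod.intCast_zmod_eq_zero_iff_dvd _ 3).2 h)
  simpa only [← Int.cast_sub, ← Int.cast_add, ZMod.intCast_zmod_eq_zero_iff_dvd,
    Nat.cast_ofNat] using this

/-- If `5 n` is a sum of three squares, then `n` is of the form `y² + z² + 5 w²`. -/
theorem exists_eq_sq_add_sq_add_five_mul_sq {n p q r : ℤ} (h : 5 * n = p ^ 2 + q ^ 2 + r ^ 2) :
    ∃ w y z : ℤ, n = y ^ 2 + z ^ 2 + 5 * w ^ 2 := by
  wlog hr : 5 ∣ r generalizing p q r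
  · obtain hd | hd | hd := five_dvd_of_five_dvd_sum_three_squares ⟨n, h.symm⟩
    · exact this (p := q) (q := r) (r := p) (by linarith) hd
    · exact this (p := p) (q := r) (r := q) (by linarith) hd
    · exact absurd hd hr
  obtain ⟨w, rfl⟩ := hr
  obtain ⟨y, hy⟩ | ⟨y, hy⟩ := five_dvd_sub_or_add (p := p) (q := q)
    ⟨n - 5 * w ^ 2, by linear_combination -h⟩
  · obtain rfl : p = 5 * y + 2 * q := by linarith
    exact ⟨w, y * 2 + q, y, by linarith⟩
  · obtain rfl : p = 5 * y - 2 * q := by linarith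
    exact ⟨w, y * 2 - q, y, by linarith⟩

/-- If `15 n` is a sum of three squares, then `n` is represented by
`2 a² + 2 a c + 3 c² + 3 b²`. -/
theorem exists_eq_of_fifteen_mul_eq {n p q r : ℤ} (h : 15 * n = p ^ 2 + q ^ 2 + r ^ 2) :
    ∃ a b c : ℤ, n = 2 * a ^ 2 + 2 * a * c + 3 * c ^ 2 + 3 * b ^ 2 := by
  wlog h3 : 3 ∣ p - q ∧ 3 ∣ p - r generalizing p q r
  · obtain ⟨hq, hr⟩ := three_dvd_sub_or_add (p := p) (q := q) (r := r)
      ⟨5 * n, by linarith⟩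
    obtain ⟨q', hq', hq'3⟩ : ∃ q', q' ^ 2 = q ^ 2 ∧ 3 ∣ p - q' :=
      hq.elim (fun hd => ⟨q, rfl, hd⟩) (fun hd => ⟨-q, by ring, by simpa using hd⟩)
    obtain ⟨r', hr', hr'3⟩ : ∃ r', r' ^ 2 = r ^ 2 ∧ 3 ∣ p - r' :=
      hr.elim (fun hd => ⟨r, rfl, hd⟩) (fun hd => ⟨-r, by ring, by simpa using hd⟩)
    exact this (by rw [h, hq', hr']) ⟨hq'3, hr'3⟩
  wlog hp : 5 ∣ p generalizing p q r
  · obtain hd | hd | hd := five_dvd_of_five_dvd_sum_three_squares (p := p) (q := q) (r := r)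
      ⟨3 * n, by linarith⟩
    · exact absurd hd hp
    · exact this (p := q) (q := p) (r := r) (by linarith) (by omega) hd
    · exact this (p := r) (q := q) (r := p) (by linarith) (by omega) hd
  wlog hrq : 5 ∣ r - 2 * q generalizing q r
  · obtain ⟨t, rfl⟩ := hp
    obtain hd | hd := five_dvd_sub_or_add (p := r) (q := q)
      ⟨3 * n - 5 * t ^ 2, by linear_combination -h⟩
    · exact absurd hd hrq
    · exact this (q := r) (r := q) (by linarith) (by omega) (by omega)
  obtain ⟨a, ha⟩ : 15 ∣ 2 * p + 2 * q - r := by omega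
  obtain ⟨b, hb⟩ : 15 ∣ q + 2 * r := by omega
  obtain ⟨c, hc⟩ : 15 ∣ p - 2 * q + r := by omega
  obtain rfl : p = 5 * a + 5 * c := by omega
  obtain rfl : q = 2 * a + 3 * b - 4 * c := by omega
  obtain rfl : r = -a + 6 * b + 2 * c := by omega
  exact ⟨a, b, c, by linarith⟩

theorem stmt_9 (n : ℕ) :
    ∃ w x y z : ℤ, (n : ℤ) = w ^ 2 + x ^ 2 + y ^ 2 + z ^ 2 ∧
      (2 * w + x) * (2 * w + x - y - 3 * z) = 0 ∧
      ∃ t : ℤ, (10 * w + 5 * x) ^ 2 + (12 * y + 36 * z) ^ 2 = t ^ 2 := by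
  suffices h : ∃ w x y z : ℤ, (n : ℤ) = w ^ 2 + x ^ 2 + y ^ 2 + z ^ 2 ∧
      (2 * w + x) * (2 * w + x - y - 3 * z) = 0 by
    obtain ⟨w, x, y, z, hn, h0⟩ := h
    refine ⟨w, x, y, z, hn, h0, ?_⟩
    obtain h | h := mul_eq_zero.1 h0
    · exact ⟨12 * y + 36 * z, by linear_combination 25 * (2 * w + x) * h⟩
    · exact ⟨13 * (y + 3 * z), by linear_combination 25 * (2 * w + x + y + 3 * z) * h⟩
  have of_five {n : ℕ} {u v t : ℤ} (h : ((5 * n : ℕ) : ℤ) = u ^ 2 + v ^ 2 + t ^ 2) :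
      ∃ w x y z : ℤ, (n : ℤ) = w ^ 2 + x ^ 2 + y ^ 2 + z ^ 2 ∧
      (2 * w + x) * (2 * w + x - y - 3 * z) = 0 := by
    obtain ⟨w, y, z, h⟩ := exists_eq_sq_add_sq_add_five_mul_sq (n := n) (by rwa [Nat.cast_mul] at h)
    exact ⟨w, -2 * w, y, z, by linear_combination h, by ring⟩
  induction n using Nat.strong_induction_on with
  | _ n ih =>
    obtain h4 | h4 | h4 | h4 : n % 4 = 0 ∨ n % 4 = 1 ∨ n % 4 = 2 ∨ n % 4 = 3 := by omega
    · obtain ⟨m, rfl⟩ := Nat.dvd_of_mod_eq_zero h4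
      obtain rfl | hm := Nat.eq_zero_or_pos m
      · exact ⟨0, 0, 0, 0, by simp⟩
      · obtain ⟨w, x, y, z, h, h0⟩ := ih m (by omega)
        exact ⟨2 * w, 2 * x, 2 * y, 2 * z, by push_cast; linear_combination 4 * h,
          by linear_combination 4 * h0⟩
    · obtain ⟨u, v, t, h⟩ := exists_sum_three_squares_of_mod_four_eq_one (N := 5 * n) (by omega)
      exact of_five h
    · obtain ⟨u, v, t, h⟩ := exists_sum_three_squares_of_mod_four_eq_two (N := 5 * n) (by omega)
      exact of_five h
    · obtain ⟨u, v, t, h⟩ := exists_sum_three_squares_of_mod_four_eq_one (N := 15 * n) (by omega)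
      obtain ⟨a, b, c, h⟩ := exists_eq_of_fifteen_mul_eq (n := n) (by rwa [Nat.cast_mul] at h)
      exact ⟨b + c, a - b + c, a + b, c, by linear_combination h, by ring⟩
end

section
/- For every natural number n the following three claims all hold: (1) there exist integers w, x, y, z with n = w^2 + x^2 + y^2 + z^2 and w·(x + y + 3z) = 0; (2) there exist integers w, x, y, z with n = w^2 + x^2 + y^2 + z^2 and (x - y)·(x + y + 3z) = 0; (3) there exist integers w, x, y, z with n = w^2 + x^2 + y^2 + z^2 such that (x + y)^2 + (4z)^2 is a perfect square. -/
open NumberTheorySymbols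

/-- An integer can be shifted by a multiple of `a > 0` to have absolute value at most `a / 2`. -/
theorem exists_add_mul_sq_le {a : ℤ} (ha : 0 < a) (f : ℤ) :
    ∃ t : ℤ, 4 * (f + a * t) ^ 2 ≤ a ^ 2 := by
  refine ⟨-((2 * f + a) / (2 * a)), ?_⟩
  have h₁ := Int.emod_nonneg (2 * f + a) (show 2 * a ≠ 0 by positivity)
  have h₂ := Int.emod_lt_of_pos (2 * f + a) (show 0 < 2 * a by positivity)
  have h₃ := Int.emod_add_mul_ediv (2 * f + a) (2 * a)
  set u := (2 * f + a) / (2 * a)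
  have h₄ : -a ≤ 2 * (f + a * -u) := by linarith
  have h₅ : 2 * (f + a * -u) ≤ a := by linarith
  nlinarith

/-- Reduction of positive definite binary quadratic forms `A x² + 2 B x y + C y²`: the form is
properly equivalent to one whose leading coefficient satisfies Gauss's bound. -/
theorem exists_binary_reduction (A : ℕ) : ∀ B C : ℤ, 0 < A → 0 < A * C - B ^ 2 →
    ∃ p q r s : ℤ, p * s - q * r = 1 ∧ 0 < A * p ^ 2 + 2 * B * p * r + C * r ^ 2 ∧
      3 * (A * p ^ 2 + 2 * B * p * r + C * r ^ 2) ^ 2 ≤ 4 * (A * C - B ^ 2) := by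
  induction A using Nat.strong_induction_on with
  | _ A ih =>
    intro B C hA hD
    have hA' : (0 : ℤ) < A := by exact_mod_cast hA
    obtain ⟨t, ht⟩ := exists_add_mul_sq_le hA' B
    set B' := B + A * t with hB'
    set C' := C + 2 * B * t + A * t ^ 2 with hC'
    have hdet : A * C' - B' ^ 2 = A * C - B ^ 2 := by rw [hB', hC']; ring
    rcases le_or_gt (A : ℤ) C' with h | h
    · refine ⟨1, 0, 0, 1, by ring, by linarith, ?_⟩
      nlinarith
    · have hC0 : 0 < C' := by
        by_contra! hle
        nlinarith [sq_nonneg B']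
      obtain ⟨c, hc⟩ := Int.eq_ofNat_of_zero_le hC0.le
      rw [hc] at h hC0 hdet
      obtain ⟨p, q, r, s, h₁, h₂, h₃⟩ := ih c (by exact_mod_cast h) (-B') A
        (by exact_mod_cast hC0) (by linarith)
      have hval : A * (t * p - r) ^ 2 + 2 * B * (t * p - r) * p + C * p ^ 2
          = c * p ^ 2 + 2 * (-B') * p * r + A * r ^ 2 := by
        rw [← hc, hB', hC']; ring
      refine ⟨t * p - r, t * q - s, p, q, by linarith, by rwa [hval], ?_⟩
      rw [hval]
      linarith

/-- A positive definite binary form of determinant one takes only sums of two squares as values. -/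
theorem binary_det_one_eq_sum_two_sq {A B C : ℤ} (hA : 0 < A) (hD : A * C - B ^ 2 = 1) (y z : ℤ) :
    ∃ u v : ℤ, A * y ^ 2 + 2 * B * y * z + C * z ^ 2 = u ^ 2 + v ^ 2 := by
  lift A to ℕ using hA.le
  obtain ⟨p, q, r, s, h₁, h₂, h₃⟩ := exists_binary_reduction A B C (by exact_mod_cast hA)
    (by linarith)
  set A' := A * p ^ 2 + 2 * B * p * r + C * r ^ 2 with hA'
  have hone : A' = 1 := by nlinarith
  obtain ⟨y', z', rfl, rfl⟩ : ∃ y' z', y = p * y' + q * z' ∧ z = r * y' + s * z' :=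
    ⟨s * y - q * z, p * z - r * y, by linear_combination -y * h₁, by linear_combination -z * h₁⟩
  set E := A * p * q + B * (p * s + q * r) + C * r * s with hE
  set F := A * q ^ 2 + 2 * B * q * s + C * s ^ 2 with hF
  have hdet : A' * F - E ^ 2 = 1 := by
    have : A' * F - E ^ 2 = (p * s - q * r) ^ 2 * (A * C - B ^ 2) := by rw [hA', hE, hF]; ring
    rw [this, h₁, hD]; ring
  refine ⟨y' + E * z', z', ?_⟩
  have : A * (p * y' + q * z') ^ 2 + 2 * B * (p * y' + q * z') * (r * y' + s * z')
      + C * (r * y' + s * z') ^ 2 = A' * y' ^ 2 + 2 * E * y' * z' + F * z' ^ 2 := by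
    rw [hA', hE, hF]; ring
  rw [this]
  rw [hone] at hdet ⊢
  linear_combination z' ^ 2 * hdet

theorem pos_and_lt_of_reduced {a A b f : ℤ} (ha : 2 ≤ a) (hA : 0 < A) (hA2 : 3 * A ^ 2 ≤ 4 * a)
    (hf : 4 * f ^ 2 ≤ a ^ 2) (h : a * b - f ^ 2 = A) : 0 < b ∧ b < a := by
  have hb : 0 < b := by
    by_contra! hle
    nlinarith [sq_nonneg f]
  refine ⟨hb, ?_⟩
  by_contra! hle
  have h₁ : a * a ≤ a * b := by gcongr
  have h₂ : (3 * a ^ 2) ^ 2 ≤ (4 * A) ^ 2 := by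
    refine pow_le_pow_left₀ (by positivity) ?_ 2
    linarith
  have h₃ : a * 2 ^ 3 ≤ a * a ^ 3 := by gcongr
  linarith

/-- A positive definite ternary form of determinant one takes only sums of three squares as
values. -/
theorem ternary_det_one_eq_sum_three_sq (a : ℕ) : ∀ b c d e f : ℤ, 0 < a → 0 < a * b - f ^ 2 →
    a * b * c + 2 * d * e * f - a * d ^ 2 - b * e ^ 2 - c * f ^ 2 = 1 → ∀ x y z : ℤ,
    ∃ u v w : ℤ, a * x ^ 2 + b * y ^ 2 + c * z ^ 2 + 2 * d * y * z + 2 * e * x * z + 2 * f * x * y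
      = u ^ 2 + v ^ 2 + w ^ 2 := by
  induction a using Nat.strong_induction_on with
  | _ a ih =>
    intro b c d e f ha hA hdet x y z
    have ha' : (0 : ℤ) < a := by exact_mod_cast ha
    rcases eq_or_ne a 1 with rfl | hne
    · push_cast at *
      obtain ⟨u, v, h⟩ := binary_det_one_eq_sum_two_sq (A := b - f ^ 2) (B := d - e * f)
        (C := c - e ^ 2) (by linarith) (by linear_combination hdet) y z
      exact ⟨x + f * y + e * z, u, v, by linear_combination h⟩
    have ha2 : (2 : ℤ) ≤ a := by exact_mod_cast (show 2 ≤ a by omega)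
    have hG : (a * b - f ^ 2) * (a * c - e ^ 2) - (a * d - e * f) ^ 2 = a := by
      linear_combination a * hdet
    obtain ⟨p, q, r, s, h₁, h₂, h₃⟩ : ∃ p q r s : ℤ, p * s - q * r = 1 ∧
        0 < (a * b - f ^ 2) * p ^ 2 + 2 * (a * d - e * f) * p * r + (a * c - e ^ 2) * r ^ 2 ∧
        3 * ((a * b - f ^ 2) * p ^ 2 + 2 * (a * d - e * f) * p * r + (a * c - e ^ 2) * r ^ 2) ^ 2
          ≤ 4 * ((a * b - f ^ 2) * (a * c - e ^ 2) - (a * d - e * f) ^ 2) := by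
      obtain ⟨A, hA'⟩ := Int.eq_ofNat_of_zero_le hA.le
      rw [hA'] at hA hG ⊢
      exact exists_binary_reduction A _ _ (by exact_mod_cast hA) (by rw [hG]; exact ha')
    rw [hG] at h₃
    set A' := (a * b - f ^ 2) * p ^ 2 + 2 * (a * d - e * f) * p * r + (a * c - e ^ 2) * r ^ 2
      with hA'
    obtain ⟨t, ht⟩ := exists_add_mul_sq_le ha' (f * p + e * r)
    set f' := f * p + e * r + a * t with hf'
    set e' := f * q + e * s with he'
    set b' := b * p ^ 2 + 2 * d * p * r + c * r ^ 2 + 2 * (f * p + e * r) * t + a * t ^ 2 with hb'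
    set c' := b * q ^ 2 + 2 * d * q * s + c * s ^ 2 with hc'
    set d' := b * p * q + d * (p * s + q * r) + c * r * s + e' * t with hd'
    have hab : a * b' - f' ^ 2 = A' := by rw [hb', hf', hA']; ring
    obtain ⟨hb0, hba⟩ := pos_and_lt_of_reduced ha2 h₂ h₃ ht hab
    have hdet' : b' * a * c' + 2 * e' * d' * f' - b' * e' ^ 2 - a * d' ^ 2 - c' * f' ^ 2 = 1 := by
      have : b' * a * c' + 2 * e' * d' * f' - b' * e' ^ 2 - a * d' ^ 2 - c' * f' ^ 2
          = (p * s - q * r) ^ 2 *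
            (a * b * c + 2 * d * e * f - a * d ^ 2 - b * e ^ 2 - c * f ^ 2) := by
        rw [hb', hc', hd', he', hf']; ring
      rw [this, h₁, hdet]; ring
    obtain ⟨y', z', rfl, rfl⟩ : ∃ y' z', y = p * y' + q * z' ∧ z = r * y' + s * z' :=
      ⟨s * y - q * z, p * z - r * y, by linear_combination -y * h₁, by linear_combination -z * h₁⟩
    obtain ⟨β, hβ⟩ := Int.eq_ofNat_of_zero_le hb0.le
    obtain ⟨u, v, w, h⟩ := ih β (by rw [hβ] at hba; exact_mod_cast hba) a c' e' d' f'
      (by rw [hβ] at hb0; exact_mod_cast hb0) (by rw [← hβ]; linarith)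
      (by rw [← hβ]; linarith) y' (x - t * y') z'
    refine ⟨u, v, w, ?_⟩
    rw [← h, ← hβ, hb', hc', hd', he', hf']
    ring

/-- If `-d` is a square modulo `d n - 1`, then `n` is a sum of three squares. -/
theorem sum_three_sq_of_dvd_sq_add {n d a : ℤ} (hd : 0 < d) (hn : 0 < d * n - 1)
    (h : d * n - 1 ∣ a ^ 2 + d) : ∃ x y z : ℤ, n = x ^ 2 + y ^ 2 + z ^ 2 := by
  obtain ⟨k, hk⟩ := h
  have hk0 : 0 < k := by
    by_contra! hle
    nlinarith [sq_nonneg a]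
  lift k to ℕ using hk0.le
  obtain ⟨u, v, w, h⟩ := ternary_det_one_eq_sum_three_sq k (d * n - 1) n 0 1 a
    (by exact_mod_cast hk0) (by linarith) (by linear_combination -n * hk) 0 0 1
  exact ⟨u, v, w, by linear_combination h⟩

theorem exists_dvd_sq_add_of_jacobiSym {p : ℕ} (hp : p.Prime) {d : ℤ} (h : J(-d | p) = 1) :
    ∃ a : ℤ, (p : ℤ) ∣ a ^ 2 + d := by
  have := Fact.mk hp
  obtain ⟨r, hr⟩ := ZMod.isSquare_of_jacobiSym_eq_one h
  refine ⟨r.valMinAbs, (ZMod.intCast_zmod_eq_zero_iff_dvd _ p).mp ?_⟩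
  push_cast at hr
  rw [Int.cast_add, Int.cast_pow, ZMod.coe_valMinAbs, sq, ← hr]
  simp

theorem sum_three_sq_of_mod_four_eq_two {n : ℕ} (hn : n % 4 = 2) :
    ∃ x y z : ℤ, (n : ℤ) = x ^ 2 + y ^ 2 + z ^ 2 := by
  have hco : (n - 1).Coprime (4 * n) := by
    refine Nat.Coprime.mul_right ?_ ?_
    · exact Nat.Coprime.pow_right 2 (Nat.coprime_two_right.mpr (Nat.odd_iff.mpr (by omega)))
    · exact (Nat.coprime_self_sub_left (by omega)).mpr (Nat.coprime_one_left n)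
  obtain ⟨p, hlt, hp, hmod⟩ :=
    Nat.forall_exists_prime_gt_and_modEq (n - 1) (q := 4 * n) (by omega) hco
  obtain ⟨v, hv⟩ := (Nat.modEq_iff_dvd' hlt.le).mp hmod.symm
  obtain ⟨d, hd⟩ : ∃ d, d = 4 * v + 1 := ⟨_, rfl⟩
  have hpd : p + 1 = d * n := by
    have : d * n = 4 * n * v + n := by rw [hd]; ring
    omega
  have hpd' : (d : ℤ) * n - 1 = p := by
    have : (p : ℤ) + 1 = d * n := by exact_mod_cast hpd
    linarith
  have hp4 : p % 4 = 1 := by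
    have : p = 4 * (n * v) + (n - 1) := by rw [← mul_assoc]; omega
    omega
  have hdodd : Odd d := Nat.odd_iff.mpr (by omega)
  have hpodd : Odd p := Nat.odd_iff.mpr (by omega)
  have hJ : J(-(d : ℤ) | p) = 1 := by
    have hpJ : J((p : ℤ) | d) = J(-1 | d) :=
      jacobiSym.mod_left' (by rw [← hpd', sub_eq_neg_add, Int.add_mul_emod_self_left])
    rw [neg_eq_neg_one_mul, jacobiSym.mul_left, jacobiSym.at_neg_one hpodd,
      ZMod.χ₄_nat_one_mod_four hp4,
      jacobiSym.quadratic_reciprocity_one_mod_four (by omega) hpodd, hpJ,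
      jacobiSym.at_neg_one hdodd, ZMod.χ₄_nat_one_mod_four (by omega)]
    rfl
  obtain ⟨a, ha⟩ := exists_dvd_sq_add_of_jacobiSym hp hJ
  exact sum_three_sq_of_dvd_sq_add (d := d) (by omega) (by rw [hpd']; exact_mod_cast hp.pos)
    (by rwa [hpd'])

/-- Odd case of the three-square theorem, with `c` the residue modulo 8 of the auxiliary `d`. -/
theorem sum_three_sq_of_odd {n c : ℕ} (hn : n % 8 = 1 ∧ c = 3 ∨ n % 8 = 3 ∧ c = 1 ∨
    n % 8 = 5 ∧ c = 3) : ∃ x y z : ℤ, (n : ℤ) = x ^ 2 + y ^ 2 + z ^ 2 := by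
  obtain ⟨m, hm⟩ : ∃ m, c * n = 2 * m + 1 := by
    rcases hn with ⟨h, rfl⟩ | ⟨h, rfl⟩ | ⟨h, rfl⟩
    · exact ⟨(3 * n) / 2, by omega⟩
    · exact ⟨n / 2, by omega⟩
    · exact ⟨(3 * n) / 2, by omega⟩
  have hm2 : m % 2 = 1 := by
    rcases hn with ⟨h, rfl⟩ | ⟨h, rfl⟩ | ⟨h, rfl⟩ <;> omega
  have hco : m.Coprime (4 * n) := by
    refine Nat.Coprime.mul_right ?_ ?_
    · exact Nat.Coprime.pow_right 2 (Nat.coprime_two_right.mpr (Nat.odd_iff.mpr hm2))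
    · refine Nat.isCoprime_iff_coprime.mp ⟨-2, c, ?_⟩
      have : (c : ℤ) * n = 2 * m + 1 := by exact_mod_cast hm
      linear_combination this
  obtain ⟨p, hlt, hp, hmod⟩ :=
    Nat.forall_exists_prime_gt_and_modEq m (q := 4 * n) (by omega) hco
  obtain ⟨v, hv⟩ := (Nat.modEq_iff_dvd' hlt.le).mp hmod.symm
  obtain ⟨d, hd⟩ : ∃ d, d = 8 * v + c := ⟨_, rfl⟩
  have hpm : p = 4 * (n * v) + m := by rw [← mul_assoc]; omega
  have hpd : 2 * p + 1 = d * n := by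
    have : d * n = 8 * (n * v) + c * n := by rw [hd]; ring
    omega
  have hpd' : (d : ℤ) * n - 1 = 2 * p := by
    have : 2 * (p : ℤ) + 1 = d * n := by exact_mod_cast hpd
    linarith
  have hdodd : Odd d := Nat.odd_iff.mpr (by omega)
  have hpodd : Odd p := Nat.odd_iff.mpr (by omega)
  have hpJ : J((p : ℤ) | d) = 1 := by
    have h₁ : J(-2 | d) = 1 := by
      rw [jacobiSym.at_neg_two hdodd, ZMod.χ₈'_nat_eq_if_mod_eight]
      rw [if_neg (by omega), if_pos (by omega)]
    have h₂ : J(-2 * (p : ℤ) | d) = J(1 | d) := by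
      refine jacobiSym.mod_left' ?_
      rw [show -2 * (p : ℤ) = 1 - d * n by linarith]
      simp [Int.sub_emod]
    rwa [jacobiSym.mul_left, h₁, one_mul, jacobiSym.one_left] at h₂
  have hJ : J(-(d : ℤ) | p) = 1 := by
    rw [neg_eq_neg_one_mul, jacobiSym.mul_left, jacobiSym.at_neg_one hpodd]
    rcases Nat.odd_mod_four_iff.mp (Nat.odd_iff.mp hpodd) with h | h
    · rw [ZMod.χ₄_nat_one_mod_four h, jacobiSym.quadratic_reciprocity_one_mod_four' hdodd h, hpJ]
      rfl
    · have hd4 : d % 4 = 3 := by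
        rcases hn with ⟨_, rfl⟩ | ⟨_, rfl⟩ | ⟨_, rfl⟩ <;> omega
      rw [ZMod.χ₄_nat_three_mod_four h,
        jacobiSym.quadratic_reciprocity_three_mod_four hd4 h, hpJ]
      rfl
  obtain ⟨a, ha⟩ := exists_dvd_sq_add_of_jacobiSym hp hJ
  have h2p : IsCoprime (2 : ℤ) p := by
    exact_mod_cast Nat.isCoprime_iff_coprime.mpr (Nat.coprime_two_left.mpr hpodd)
  have key : ∃ a : ℤ, (2 * p : ℤ) ∣ a ^ 2 + d := by
    have hd2 : (d : ℤ) % 2 = 1 := by exact_mod_cast Nat.odd_iff.mp hdodd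
    have hp2 : (p : ℤ) % 2 = 1 := by exact_mod_cast Nat.odd_iff.mp hpodd
    rcases Int.emod_two_eq_zero_or_one a with h | h
    · refine ⟨a + p, h2p.mul_dvd (Int.dvd_of_emod_eq_zero ?_) ?_⟩
      · simp [sq, Int.add_emod, Int.mul_emod, h, hd2, hp2]
      · rw [show (a + p) ^ 2 + (d : ℤ) = a ^ 2 + d + p * (2 * a + p) by ring]
        exact dvd_add ha (dvd_mul_right _ _)
    · refine ⟨a, h2p.mul_dvd (Int.dvd_of_emod_eq_zero ?_) ha⟩
      simp [sq, Int.add_emod, Int.mul_emod, h, hd2]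
  obtain ⟨a, ha⟩ := key
  exact sum_three_sq_of_dvd_sq_add (d := d) (by omega)
    (by rw [hpd']; have := hp.pos; omega) (by rwa [hpd'])

/-- The three-square theorem for integers not divisible by four. -/
theorem sum_three_sq_of_mod_eight {n : ℕ} (h4 : n % 4 ≠ 0) (h7 : n % 8 ≠ 7) :
    ∃ x y z : ℤ, (n : ℤ) = x ^ 2 + y ^ 2 + z ^ 2 := by
  by_cases h2 : n % 4 = 2
  · exact sum_three_sq_of_mod_four_eq_two h2
  by_cases h3 : n % 8 = 3
  · exact sum_three_sq_of_odd (c := 1) (by omega)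
  · exact sum_three_sq_of_odd (c := 3) (by omega)

theorem exists_orthogonal_of_congr {n a b c : ℤ} (h : 11 * n = a ^ 2 + b ^ 2 + c ^ 2)
    (hb : 11 ∣ b - a) (hc : 11 ∣ c - 3 * a) :
    ∃ w x y z : ℤ, n = w ^ 2 + x ^ 2 + y ^ 2 + z ^ 2 ∧ x + y + 3 * z = 0 := by
  obtain ⟨s, hs⟩ := hb
  obtain ⟨t, ht⟩ := hc
  obtain rfl : b = a + 11 * s := by linarith
  obtain rfl : c = 3 * a + 11 * t := by linarith
  exact ⟨a + s + 3 * t, 3 * s - t, t, -s, by linarith, by ring⟩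

theorem isotropic_mod_eleven : ∀ a b c : ZMod 11, a ^ 2 + b ^ 2 + c ^ 2 = 0 →
    ((b = a ∨ b = -a) ∧ (c = 3 * a ∨ c = -(3 * a))) ∨
    ((c = a ∨ c = -a) ∧ (b = 3 * a ∨ b = -(3 * a))) ∨
    ((c = b ∨ c = -b) ∧ (a = 3 * b ∨ a = -(3 * b))) := by
  decide

/-- If `11 n` is a sum of three squares, then `n` is the norm of a quaternion whose vector part is
orthogonal to `(1, 1, 3)`. -/
theorem exists_orthogonal_of_sum_three_sq {n a b c : ℤ} (h : 11 * n = a ^ 2 + b ^ 2 + c ^ 2) :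
    ∃ w x y z : ℤ, n = w ^ 2 + x ^ 2 + y ^ 2 + z ^ 2 ∧ x + y + 3 * z = 0 := by
  have aux : ∀ {a b c : ℤ}, 11 * n = a ^ 2 + b ^ 2 + c ^ 2 →
      ((b : ZMod 11) = a ∨ (b : ZMod 11) = -a) →
      ((c : ZMod 11) = 3 * a ∨ (c : ZMod 11) = -(3 * a)) →
      ∃ w x y z : ℤ, n = w ^ 2 + x ^ 2 + y ^ 2 + z ^ 2 ∧ x + y + 3 * z = 0 := by
    intro a b c h hb hc
    have hdvd : ∀ k : ℤ, (k : ZMod 11) = 0 → (11 : ℤ) ∣ k := fun k hk => by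
      exact_mod_cast (ZMod.intCast_zmod_eq_zero_iff_dvd k 11).mp hk
    obtain ⟨b', hb2, hb'⟩ : ∃ b' : ℤ, b' ^ 2 = b ^ 2 ∧ (11 : ℤ) ∣ b' - a := by
      rcases hb with hb | hb
      · exact ⟨b, rfl, hdvd _ (by push_cast; rw [hb]; ring)⟩
      · exact ⟨-b, by ring, hdvd _ (by push_cast; rw [hb]; ring)⟩
    obtain ⟨c', hc2, hc'⟩ : ∃ c' : ℤ, c' ^ 2 = c ^ 2 ∧ (11 : ℤ) ∣ c' - 3 * a := by
      rcases hc with hc | hc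
      · exact ⟨c, rfl, hdvd _ (by push_cast; rw [hc]; ring)⟩
      · exact ⟨-c, by ring, hdvd _ (by push_cast; rw [hc]; ring)⟩
    exact exists_orthogonal_of_congr (by rw [h, hb2, hc2]) hb' hc'
  have hmod : (a : ZMod 11) ^ 2 + (b : ZMod 11) ^ 2 + (c : ZMod 11) ^ 2 = 0 := by
    have := congrArg (Int.cast : ℤ → ZMod 11) h
    push_cast at this
    rw [← this, show (11 : ZMod 11) = 0 from rfl, zero_mul]
  rcases isotropic_mod_eleven a b c hmod with ⟨h₁, h₂⟩ | ⟨h₁, h₂⟩ | ⟨h₁, h₂⟩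
  · exact aux h h₁ h₂
  · exact aux (by linarith : 11 * n = a ^ 2 + c ^ 2 + b ^ 2) h₁ h₂
  · exact aux (by linarith : 11 * n = b ^ 2 + c ^ 2 + a ^ 2) h₁ h₂

theorem exists_orthogonal_of_mod_eight {n : ℕ} (h4 : n % 4 ≠ 0) (h5 : n % 8 ≠ 5) :
    ∃ w x y z : ℤ, (n : ℤ) = w ^ 2 + x ^ 2 + y ^ 2 + z ^ 2 ∧ x + y + 3 * z = 0 := by
  obtain ⟨a, b, c, h⟩ := sum_three_sq_of_mod_eight (n := 11 * n) (by omega) (by omega)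
  exact exists_orthogonal_of_sum_three_sq (by exact_mod_cast h)

theorem sum_sq_add_two_mul_sq_of_double {n x y z : ℤ} (h : 2 * n = x ^ 2 + y ^ 2 + z ^ 2) :
    ∃ p q r : ℤ, n = p ^ 2 + q ^ 2 + 2 * r ^ 2 := by
  have aux : ∀ {x y z : ℤ}, 2 * n = x ^ 2 + y ^ 2 + z ^ 2 → z % 2 = 0 →
      ∃ p q r : ℤ, n = p ^ 2 + q ^ 2 + 2 * r ^ 2 := by
    intro x y z h hz
    have hxy : (x + y) % 2 = 0 := by
      have h₁ : (x ^ 2 + y ^ 2 + z ^ 2) % 2 = 0 := by omega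
      rcases Int.emod_two_eq_zero_or_one x with hx | hx <;>
      rcases Int.emod_two_eq_zero_or_one y with hy | hy <;>
      simp [sq, Int.add_emod, Int.mul_emod, hx, hy, hz] at h₁ ⊢
    obtain ⟨p, hp⟩ := Int.dvd_of_emod_eq_zero hxy
    obtain ⟨r, rfl⟩ := Int.dvd_of_emod_eq_zero hz
    obtain rfl : x = 2 * p - y := by linarith
    exact ⟨p, p - y, r, by linarith⟩
  rcases Int.emod_two_eq_zero_or_one z with hz | hz
  · exact aux h hz
  rcases Int.emod_two_eq_zero_or_one y with hy | hy
  · exact aux (by linarith : 2 * n = x ^ 2 + z ^ 2 + y ^ 2) hy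
  have hx : x % 2 = 0 := by
    have h₁ : (x ^ 2 + y ^ 2 + z ^ 2) % 2 = 0 := by omega
    rcases Int.emod_two_eq_zero_or_one x with hx | hx
    · exact hx
    · simp [sq, Int.add_emod, Int.mul_emod, hx, hy, hz] at h₁
  exact aux (by linarith : 2 * n = y ^ 2 + z ^ 2 + x ^ 2) hx

/-- The form `p² + q² + 2 r²` represents every integer not divisible by four, except those
congruent to 14 modulo 16. -/
theorem sum_sq_add_two_mul_sq_of_mod_sixteen {n : ℕ} (h4 : n % 4 ≠ 0) (h14 : n % 16 ≠ 14) :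
    ∃ p q r : ℤ, (n : ℤ) = p ^ 2 + q ^ 2 + 2 * r ^ 2 := by
  rcases Nat.even_or_odd' n with ⟨m, rfl | rfl⟩
  · obtain ⟨x, y, z, h⟩ := sum_three_sq_of_mod_eight (n := m) (by omega) (by omega)
    exact ⟨x + y, x - y, z, by push_cast; rw [h]; ring⟩
  · obtain ⟨x, y, z, h⟩ := sum_three_sq_of_mod_eight (n := 2 * (2 * m + 1)) (by omega) (by omega)
    exact sum_sq_add_two_mul_sq_of_double (by exact_mod_cast h)

theorem stmt_10 (n : ℕ) :
    (∃ w x y z : ℤ, (n : ℤ) = w ^ 2 + x ^ 2 + y ^ 2 + z ^ 2 ∧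
        w * (x + y + 3 * z) = 0) ∧
    (∃ w x y z : ℤ, (n : ℤ) = w ^ 2 + x ^ 2 + y ^ 2 + z ^ 2 ∧
        (x - y) * (x + y + 3 * z) = 0) ∧
    (∃ w x y z : ℤ, (n : ℤ) = w ^ 2 + x ^ 2 + y ^ 2 + z ^ 2 ∧
        ∃ t : ℤ, (x + y) ^ 2 + (4 * z) ^ 2 = t ^ 2) := by
  induction n using Nat.strong_induction_on with
  | _ n ih =>
    by_cases h4 : n % 4 = 0
    · obtain ⟨m, rfl⟩ := Nat.dvd_of_mod_eq_zero h4
      rcases Nat.eq_zero_or_pos m with rfl | hm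
      · exact ⟨⟨0, 0, 0, 0, by simp⟩, ⟨0, 0, 0, 0, by simp⟩, ⟨0, 0, 0, 0, by simp, 0, by simp⟩⟩
      obtain ⟨⟨w₁, x₁, y₁, z₁, h₁, e₁⟩, ⟨w₂, x₂, y₂, z₂, h₂, e₂⟩, w₃, x₃, y₃, z₃, h₃, t, e₃⟩ :=
        ih m (by omega)
      push_cast
      exact ⟨⟨2 * w₁, 2 * x₁, 2 * y₁, 2 * z₁, by rw [h₁]; ring, by linear_combination 4 * e₁⟩,
        ⟨2 * w₂, 2 * x₂, 2 * y₂, 2 * z₂, by rw [h₂]; ring, by linear_combination 4 * e₂⟩,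
        ⟨2 * w₃, 2 * x₃, 2 * y₃, 2 * z₃, by rw [h₃]; ring, 2 * t, by linear_combination 4 * e₃⟩⟩
    refine ⟨?_, ?_, ?_⟩
    · by_cases h7 : n % 8 = 7
      · obtain ⟨w, x, y, z, h, e⟩ := exists_orthogonal_of_mod_eight h4 (by omega)
        exact ⟨w, x, y, z, h, by rw [e, mul_zero]⟩
      · obtain ⟨x, y, z, h⟩ := sum_three_sq_of_mod_eight h4 h7
        exact ⟨0, x, y, z, by rw [h]; ring, by ring⟩
    · by_cases h14 : n % 16 = 14
      · obtain ⟨w, x, y, z, h, e⟩ := exists_orthogonal_of_mod_eight h4 (by omega)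
        exact ⟨w, x, y, z, h, by rw [e, mul_zero]⟩
      · obtain ⟨p, q, r, h⟩ := sum_sq_add_two_mul_sq_of_mod_sixteen h4 h14
        exact ⟨p, r, r, q, by rw [h]; ring, by ring⟩
    · by_cases h7 : n % 8 = 7
      · obtain ⟨p, q, r, h⟩ := sum_sq_add_two_mul_sq_of_mod_sixteen h4 (by omega)
        exact ⟨p, r, -r, q, by rw [h]; ring, 4 * q, by ring⟩
      · obtain ⟨x, y, z, h⟩ := sum_three_sq_of_mod_eight h4 h7
        exact ⟨x, y, z, 0, by rw [h]; ring, y + z, by ring⟩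
end

section
/- For every positive integer n the following four claims all hold: (1) there exist integers w, x, y, z with w ≠ 0, n = w^2 + x^2 + y^2 + z^2, and x^2·y^2 + 9y^2·z^2 + 9z^2·x^2 a perfect square; (2) there exist integers w, x, y, z with w ≠ 0, n = w^2 + x^2 + y^2 + z^2, and x^2 + 12yz a perfect square; (3) there exist integers w, x, y, z with w ≠ 0, n = w^2 + x^2 + y^2 + z^2, and 9x^2 - 4yz a perfect square; (4) there exist integers w, x, y, z with w ≠ 0, n = w^2 + x^2 + y^2 + z^2, and (x + 3y)·z a perfect square. -/
/-- The ternary quadratic form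
`a x² + b y² + c z² + 2 d y z + 2 e x z + 2 f x y` with integral Gram matrix. -/
structure TernaryForm where
  a : ℤ
  b : ℤ
  c : ℤ
  d : ℤ
  e : ℤ
  f : ℤ

namespace TernaryForm

def eval (F : TernaryForm) (x y z : ℤ) : ℤ :=
  F.a * x ^ 2 + F.b * y ^ 2 + F.c * z ^ 2 + 2 * F.d * y * z + 2 * F.e * x * z + 2 * F.f * x * y

/-- The symmetric bilinear form of `F`. -/
def bilin (F : TernaryForm) (x y z u v w : ℤ) : ℤ :=
  F.a * x * u + F.b * y * v + F.c * z * w + F.d * (y * w + z * v) + F.e * (x * w + z * u)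
    + F.f * (x * v + y * u)

def det (F : TernaryForm) : ℤ :=
  F.a * F.b * F.c + 2 * F.d * F.e * F.f - F.a * F.d ^ 2 - F.b * F.e ^ 2 - F.c * F.f ^ 2

/-- Positivity of the leading principal minors. -/
structure IsPos (F : TernaryForm) : Prop where
  a_pos : 0 < F.a
  minor_pos : 0 < F.a * F.b - F.f ^ 2
  det_pos : 0 < F.det

/-- The substitution `x ↦ x + t y`. -/
def shear (F : TernaryForm) (t : ℤ) : TernaryForm where
  a := F.a
  b := F.b + 2 * t * F.f + t ^ 2 * F.a
  c := F.c
  d := F.d + t * F.e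
  e := F.e
  f := F.f + t * F.a

/-- Exchange of the variables `x` and `y`. -/
def swapXY (F : TernaryForm) : TernaryForm := ⟨F.b, F.a, F.c, F.e, F.d, F.f⟩

/-- Exchange of the variables `y` and `z`. -/
def swapYZ (F : TernaryForm) : TernaryForm := ⟨F.a, F.c, F.b, F.d, F.f, F.e⟩

/-- Properties that are invariant under unimodular substitutions. -/
structure IsInvariant (P : TernaryForm → Prop) : Prop where
  shear : ∀ F t, P F → P (F.shear t)
  swapXY : ∀ F, P F → P F.swapXY
  swapYZ : ∀ F, P F → P F.swapYZ

/-- The substitution `y ↦ y + t z`. -/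
def shearYZ (F : TernaryForm) (t : ℤ) : TernaryForm :=
  (F.swapXY.swapYZ.shear t).swapYZ.swapXY

theorem IsInvariant.shearYZ {P : TernaryForm → Prop} (hP : IsInvariant P) (F : TernaryForm)
    (t : ℤ) (h : P F) : P (F.shearYZ t) :=
  hP.swapXY _ (hP.swapYZ _ (hP.shear _ _ (hP.swapYZ _ (hP.swapXY _ h))))

theorem exists_two_mul_abs_add_mul_le {m : ℤ} (hm : 0 < m) (k : ℤ) :
    ∃ t : ℤ, 2 * |k + t * m| ≤ m := by
  have h := Int.emod_add_mul_ediv k m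
  have h₀ := Int.emod_nonneg k hm.ne'
  have h₁ := Int.emod_lt_of_pos k hm
  rcases le_total (2 * (k % m)) m with h₂ | h₂
  · refine ⟨-(k / m), ?_⟩
    rw [show k + -(k / m) * m = k % m by linarith, abs_of_nonneg h₀]
    exact h₂
  · refine ⟨-(k / m) - 1, ?_⟩
    rw [show k + (-(k / m) - 1) * m = k % m - m by linarith, abs_of_neg (by linarith)]
    linarith

theorem det_shear (F : TernaryForm) (t : ℤ) : (F.shear t).det = F.det := by
  simp only [det, shear]; ring

theorem det_swapXY (F : TernaryForm) : F.swapXY.det = F.det := by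
  simp only [det, swapXY]; ring

theorem det_swapYZ (F : TernaryForm) : F.swapYZ.det = F.det := by
  simp only [det, swapYZ]; ring

theorem det_shearYZ (F : TernaryForm) (t : ℤ) : (F.shearYZ t).det = F.det := by
  simp only [shearYZ, det_swapXY, det_swapYZ, det_shear]

theorem minor_mul_minor_sub (F : TernaryForm) :
    (F.a * F.b - F.f ^ 2) * (F.a * F.c - F.e ^ 2) - (F.a * F.d - F.e * F.f) ^ 2
      = F.a * F.det := by
  simp only [det]; ring

theorem isPos_shear {F : TernaryForm} (hF : F.IsPos) (t : ℤ) : (F.shear t).IsPos where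
  a_pos := hF.a_pos
  minor_pos := by
    have := hF.minor_pos
    simp only [shear]
    linarith
  det_pos := by rw [det_shear]; exact hF.det_pos

theorem isPos_swapXY {F : TernaryForm} (hF : F.IsPos) : F.swapXY.IsPos where
  a_pos := by
    have h₁ := hF.a_pos
    have h₂ := hF.minor_pos
    show 0 < F.b
    by_contra! h
    nlinarith [sq_nonneg F.f]
  minor_pos := by
    have := hF.minor_pos
    simp only [swapXY]
    linarith
  det_pos := by rw [det_swapXY]; exact hF.det_pos

theorem isPos_swapYZ {F : TernaryForm} (hF : F.IsPos) : F.swapYZ.IsPos where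
  a_pos := hF.a_pos
  minor_pos := by
    have h₁ := hF.minor_pos
    have h₂ := F.minor_mul_minor_sub
    have h₃ := mul_pos hF.a_pos hF.det_pos
    show 0 < F.a * F.c - F.e ^ 2
    by_contra! h
    nlinarith [sq_nonneg (F.a * F.d - F.e * F.f)]
  det_pos := by rw [det_swapYZ]; exact hF.det_pos

theorem isPos_shearYZ {F : TernaryForm} (hF : F.IsPos) (t : ℤ) : (F.shearYZ t).IsPos :=
  isPos_swapXY (isPos_swapYZ (isPos_shear (isPos_swapYZ (isPos_swapXY hF)) t))

/-- The bounds satisfied by a reduced form in the sense of Gauss. -/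
structure IsReduced (F : TernaryForm) : Prop where
  isPos : F.IsPos
  two_mul_abs_f_le : 2 * |F.f| ≤ F.a
  a_le_b : F.a ≤ F.b
  two_mul_abs_le_minor : 2 * |F.a * F.d - F.e * F.f| ≤ F.a * F.b - F.f ^ 2
  minor_le_minor : F.a * F.b - F.f ^ 2 ≤ F.a * F.c - F.e ^ 2

theorem exists_isReduced {P : TernaryForm → Prop} (hP : IsInvariant P) {F : TernaryForm}
    (hF : F.IsPos) (hPF : P F) : ∃ G : TernaryForm, P G ∧ G.det = F.det ∧ G.IsReduced := by
  let S : Set TernaryForm := {G | P G ∧ G.det = F.det ∧ G.IsPos}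
  let μ : TernaryForm → ℕ := fun G => (G.a + (G.a * G.b - G.f ^ 2)).toNat
  obtain ⟨G, ⟨hPG, hdet, hG⟩, hmin⟩ :=
    exists_minimalFor_of_wellFoundedLT (· ∈ S) μ ⟨F, hPF, rfl, hF⟩
  have hmin' : ∀ H ∈ S, G.a + (G.a * G.b - G.f ^ 2) ≤ H.a + (H.a * H.b - H.f ^ 2) := by
    intro H hH
    have h₁ := hH.2.2.a_pos
    have h₂ := hH.2.2.minor_pos
    have h₃ := hG.a_pos
    have h₄ := hG.minor_pos
    rcases le_total (μ G) (μ H) with h | h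
    · simp only [μ] at h; omega
    · have := hmin hH h
      simp only [μ] at this; omega
  clear hmin
  obtain ⟨t, ht⟩ := exists_two_mul_abs_add_mul_le hG.a_pos G.f
  obtain ⟨s, hs⟩ := exists_two_mul_abs_add_mul_le hG.minor_pos
    ((G.shear t).a * (G.shear t).d - (G.shear t).e * (G.shear t).f)
  set H := (G.shear t).shearYZ s with hH
  have hPH : P H := hP.shearYZ _ _ (hP.shear _ _ hPG)
  have hdetH : H.det = F.det := by rw [hH, det_shearYZ, det_shear, hdet]
  have hposH : H.IsPos := isPos_shearYZ (isPos_shear hG t) s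
  have ha : H.a = G.a := rfl
  have hf : H.f = G.f + t * G.a := rfl
  have hminor : H.a * H.b - H.f ^ 2 = G.a * G.b - G.f ^ 2 := by
    simp only [hH, shearYZ, shear, swapXY, swapYZ]; ring
  have hXY := hmin' _ ⟨hP.swapXY _ hPH, by rw [det_swapXY, hdetH], isPos_swapXY hposH⟩
  have hYZ := hmin' _ ⟨hP.swapYZ _ hPH, by rw [det_swapYZ, hdetH], isPos_swapYZ hposH⟩
  refine ⟨H, hPH, hdetH, hposH, by rw [ha, hf]; exact ht, ?_, ?_, ?_⟩
  · simp only [swapXY] at hXY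
    linarith
  · rw [hminor]
    convert hs using 3
    simp only [hH, shearYZ, shear, swapXY, swapYZ]; ring
  · simp only [swapYZ] at hYZ
    linarith

theorem IsReduced.three_mul_a_sq_le {F : TernaryForm} (h : F.IsReduced) :
    3 * F.a ^ 2 ≤ 4 * (F.a * F.b - F.f ^ 2) := by
  have h₁ := h.two_mul_abs_f_le
  have h₂ := mul_le_mul_of_nonneg_left h.a_le_b h.isPos.a_pos.le
  have h₃ : (2 * |F.f|) ^ 2 ≤ F.a ^ 2 := by gcongr
  rw [mul_pow, sq_abs] at h₃
  linarith

theorem IsReduced.three_mul_minor_sq_le {F : TernaryForm} (h : F.IsReduced) :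
    3 * (F.a * F.b - F.f ^ 2) ^ 2 ≤ 4 * (F.a * F.det) := by
  have h₁ := h.two_mul_abs_le_minor
  have h₂ := mul_le_mul_of_nonneg_left h.minor_le_minor h.isPos.minor_pos.le
  have h₃ : (2 * |F.a * F.d - F.e * F.f|) ^ 2 ≤ (F.a * F.b - F.f ^ 2) ^ 2 := by gcongr
  rw [mul_pow, sq_abs] at h₃
  linarith [F.minor_mul_minor_sub]

theorem IsReduced.a_pow_three_le {F : TernaryForm} (h : F.IsReduced) :
    27 * F.a ^ 3 ≤ 64 * F.det := by
  have h₀ := h.isPos.a_pos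
  have h₁ : (3 * F.a ^ 2) ^ 2 ≤ (4 * (F.a * F.b - F.f ^ 2)) ^ 2 := by
    exact pow_le_pow_left₀ (by positivity) h.three_mul_a_sq_le 2
  have h₂ := h.three_mul_minor_sq_le
  refine le_of_mul_le_mul_left ?_ h₀
  linarith

theorem isInvariant_represents (n : ℤ) :
    IsInvariant fun F => ∃ x y z, F.eval x y z = n where
  shear := by
    rintro F t ⟨x, y, z, rfl⟩
    refine ⟨x - t * y, y, z, ?_⟩
    simp only [eval, shear]; ring
  swapXY := by
    rintro F ⟨x, y, z, rfl⟩
    refine ⟨y, x, z, ?_⟩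
    simp only [eval, swapXY]; ring
  swapYZ := by
    rintro F ⟨x, y, z, rfl⟩
    refine ⟨x, z, y, ?_⟩
    simp only [eval, swapYZ]; ring

/-- `F` has a nonsingular zero modulo `m`. -/
def HasNonsingularZeroMod (m : ℤ) (F : TernaryForm) : Prop :=
  ∃ x y z u v w, m ∣ F.eval x y z ∧ ¬ m ∣ F.bilin x y z u v w

theorem isInvariant_hasNonsingularZeroMod (m : ℤ) : IsInvariant (HasNonsingularZeroMod m) where
  shear := by
    rintro F t ⟨x, y, z, u, v, w, h, h'⟩
    refine ⟨x - t * y, y, z, u - t * v, v, w, ?_, ?_⟩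
    · convert h using 1
      simp only [eval, shear]; ring
    · convert h' using 2
      simp only [bilin, shear]; ring
  swapXY := by
    rintro F ⟨x, y, z, u, v, w, h, h'⟩
    refine ⟨y, x, z, v, u, w, ?_, ?_⟩
    · convert h using 1
      simp only [eval, swapXY]; ring
    · convert h' using 2
      simp only [bilin, swapXY]; ring
  swapYZ := by
    rintro F ⟨x, y, z, u, v, w, h, h'⟩
    refine ⟨x, z, y, u, w, v, ?_, ?_⟩
    · convert h using 1
      simp only [eval, swapYZ]; ring
    · convert h' using 2
      simp only [bilin, swapYZ]; ring

theorem IsInvariant.and {P Q : TernaryForm → Prop} (hP : IsInvariant P) (hQ : IsInvariant Q) :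
    IsInvariant fun F => P F ∧ Q F where
  shear F t h := ⟨hP.shear F t h.1, hQ.shear F t h.2⟩
  swapXY F h := ⟨hP.swapXY F h.1, hQ.swapXY F h.2⟩
  swapYZ F h := ⟨hP.swapYZ F h.1, hQ.swapYZ F h.2⟩

theorem sum_three_squares_of_det_eq_one {F : TernaryForm} (hF : F.IsPos) (hdet : F.det = 1)
    {n : ℤ} (hn : ∃ x y z, F.eval x y z = n) : ∃ x y z : ℤ, n = x ^ 2 + y ^ 2 + z ^ 2 := by
  obtain ⟨G, ⟨x, y, z, rfl⟩, hG, hred⟩ := exists_isReduced (isInvariant_represents n) hF hn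
  rw [hdet] at hG
  have h₁ := hred.a_pow_three_le
  have h₂ := hred.three_mul_minor_sq_le
  have h₃ := hred.two_mul_abs_f_le
  have h₄ := hred.two_mul_abs_le_minor
  have h₅ := hred.isPos.a_pos
  have h₆ := hred.isPos.minor_pos
  obtain ⟨a, b, c, d, e, f⟩ := G
  simp only [eval, det] at *
  rw [hG] at h₁ h₂
  obtain rfl : a = 1 := by
    by_contra h
    have : 2 ≤ a := by omega
    have : 2 ^ 3 ≤ a ^ 3 := by gcongr
    omega
  obtain rfl : f = 0 := by
    rw [← abs_eq_zero]
    have := abs_nonneg f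
    omega
  obtain rfl : b = 1 := by
    by_contra h
    nlinarith [show 2 ≤ b by omega]
  obtain rfl : d = 0 := by
    rw [← abs_eq_zero]
    have := abs_nonneg d
    simp only [mul_zero, sub_zero, one_mul] at h₄
    omega
  obtain rfl : c = 1 + e ^ 2 := by linarith
  exact ⟨x + e * z, y, z, by ring⟩

theorem dvd_of_eleven_dvd_sq_add_mul_sq {x y k : ℤ} (hk : k = 1 ∨ k = 3)
    (h : (11 : ℤ) ∣ x ^ 2 + k * y ^ 2) : (11 : ℤ) ∣ x ∧ (11 : ℤ) ∣ y := by
  have key : ∀ k x y : ZMod 11, k = 1 ∨ k = 3 → x ^ 2 + k * y ^ 2 = 0 → x = 0 ∧ y = 0 := by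
    decide
  have cast_iff : ∀ m : ℤ, (m : ZMod 11) = 0 ↔ (11 : ℤ) ∣ m :=
    fun m => ZMod.intCast_zmod_eq_zero_iff_dvd m 11
  rw [← cast_iff] at h ⊢
  rw [← cast_iff]
  refine key k x y ?_ (by exact_mod_cast h)
  rcases hk with rfl | rfl <;> simp

theorem exists_sq_add_of_det_eq_eleven {F : TernaryForm} (hF : F.IsPos) (hdet : F.det = 11)
    (hF' : F.HasNonsingularZeroMod 11) {n : ℤ} (hn : ∃ x y z, F.eval x y z = n) :
    ∃ w y z : ℤ, n = w ^ 2 + 2 * y ^ 2 - 2 * y * z + 6 * z ^ 2 := by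
  obtain ⟨G, ⟨⟨x, y, z, rfl⟩, x', y', z', u, v, w, hzero, hns⟩, hG, hred⟩ := exists_isReduced
    ((isInvariant_represents n).and (isInvariant_hasNonsingularZeroMod 11)) hF ⟨hn, hF'⟩
  rw [hdet] at hG
  have h₁ := hred.a_pow_three_le
  have h₂ := hred.three_mul_minor_sq_le
  have h₃ := hred.two_mul_abs_f_le
  have h₄ := hred.two_mul_abs_le_minor
  have h₅ := hred.isPos.a_pos
  have h₆ := hred.isPos.minor_pos
  have h₇ := hred.three_mul_a_sq_le
  have h₈ := G.minor_mul_minor_sub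
  obtain ⟨a, b, c, d, e, f⟩ := G
  clear hdet hF' hn
  simp only [eval, det, bilin] at *
  rw [hG] at h₁ h₂ h₈
  have ha : a < 3 := by
    by_contra! h
    have : 3 ^ 3 ≤ a ^ 3 := by gcongr
    omega
  obtain rfl | rfl : a = 1 ∨ a = 2 := by omega
  · obtain rfl : f = 0 := by
      rw [← abs_eq_zero]
      have := abs_nonneg f
      omega
    simp only [mul_zero, zero_mul, add_zero, sub_zero, one_mul, ne_eq, OfNat.ofNat_ne_zero,
      not_false_eq_true, zero_pow] at *
    obtain rfl | rfl | rfl : b = 1 ∨ b = 2 ∨ b = 3 := by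
      have : b < 4 := by
        by_contra! h
        nlinarith
      omega
    · obtain rfl : d = 0 := by
        rw [← abs_eq_zero]
        have := abs_nonneg d
        omega
      obtain rfl : c = 11 + e ^ 2 := by linarith
      have hdvd := dvd_of_eleven_dvd_sq_add_mul_sq (x := x' + e * z') (y := y') (Or.inl rfl)
        (hzero.imp' (· - z' ^ 2) fun _ hk => by linear_combination hk)
      obtain ⟨⟨k, hk⟩, ⟨l, hl⟩⟩ := hdvd
      refine absurd ⟨k * (u + e * w) + l * v + z' * w, ?_⟩ hns
      linear_combination (u + e * w) * hk + v * hl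
    · obtain rfl | rfl | rfl : d = 0 ∨ d = 1 ∨ d = -1 := by
        have := abs_le.1 (show |d| ≤ 1 by omega)
        omega
      · omega
      · obtain rfl : c = 6 + e ^ 2 := by linarith
        exact ⟨x + e * z, y, -z, by ring⟩
      · obtain rfl : c = 6 + e ^ 2 := by linarith
        exact ⟨x + e * z, y, z, by ring⟩
    · have hd : d ^ 2 = 1 := by
        obtain rfl | rfl | rfl : d = 0 ∨ d = 1 ∨ d = -1 := by
          have := abs_le.1 (show |d| ≤ 1 by omega)
          omega
        all_goals omega
      obtain rfl : c = 4 + e ^ 2 := by linarith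
      have hdvd := dvd_of_eleven_dvd_sq_add_mul_sq (x := 3 * y' + d * z') (y := x' + e * z')
        (Or.inr rfl)
        (hzero.imp' (3 * · - z' ^ 2) fun _ hk => by
          linear_combination 3 * hk + z' ^ 2 * hd)
      obtain ⟨⟨k, hk⟩, ⟨l, hl⟩⟩ := hdvd
      refine absurd ?_ hns
      refine IsCoprime.dvd_of_dvd_mul_left (x := (11 : ℤ)) (y := 3) (by norm_num) ?_
      refine ⟨3 * l * (u + e * w) + k * (3 * v + d * w) + z' * w, ?_⟩
      linear_combination 3 * (u + e * w) * hl + (3 * v + d * w) * hk - z' * w * hd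
  · generalize hM : 2 * b - f ^ 2 = M at *
    generalize hg : 2 * d - e * f = g at *
    have hM₅ : M < 6 := by
      by_contra! h
      nlinarith
    obtain rfl | rfl | rfl : M = 3 ∨ M = 4 ∨ M = 5 := by omega
    all_goals
      obtain ⟨hg₁, hg₂⟩ := abs_le.1 (show |g| ≤ 2 by omega)
      interval_cases g <;> omega

end TernaryForm

theorem exists_prime_eq_add_mul {a q : ℤ} (hq : 0 < q) (h : IsCoprime a q) :
    ∃ p k : ℕ, p.Prime ∧ (p : ℤ) = a + q * k := by
  lift q to ℕ using hq.le
  obtain ⟨p, hp, hprime, hmod⟩ :=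
    Nat.forall_exists_prime_gt_and_zmodEq a.toNat (q := q) (by omega) h
  obtain ⟨k, hk⟩ := hmod.symm.dvd
  have hk₀ : 0 ≤ k := by
    by_contra! hneg
    have : (q : ℤ) * k < 0 := mul_neg_of_pos_of_neg hq hneg
    omega
  lift k to ℕ using hk₀
  exact ⟨p, k, hprime, by linarith⟩

open NumberTheorySymbols ZMod

theorem exists_dvd_add_sq_of_jacobiSym_neg {p : ℕ} (hp : p.Prime) {d : ℤ} (h : J(-d | p) = 1) :
    ∃ b : ℤ, (p : ℤ) ∣ d + b ^ 2 := by
  have : Fact p.Prime := ⟨hp⟩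
  obtain ⟨y, hy⟩ := isSquare_of_jacobiSym_eq_one h
  obtain ⟨b, rfl⟩ := ZMod.intCast_surjective y
  refine ⟨b, (ZMod.intCast_zmod_eq_zero_iff_dvd _ p).1 ?_⟩
  push_cast at hy ⊢
  linear_combination -hy

theorem exists_two_mul_dvd_add_sq {p : ℕ} (hp : p.Prime) (hodd : Odd (p : ℤ)) {d : ℤ}
    (hd : Odd d) (h : J(-d | p) = 1) : ∃ b : ℤ, 2 * (p : ℤ) ∣ d + b ^ 2 := by
  obtain ⟨b₀, hb₀⟩ := exists_dvd_add_sq_of_jacobiSym_neg hp h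
  obtain ⟨b, hb, hpb⟩ : ∃ b : ℤ, Odd b ∧ (p : ℤ) ∣ d + b ^ 2 := by
    rcases Int.even_or_odd b₀ with hb | hb
    · refine ⟨b₀ + p, hb.add_odd hodd, hb₀.imp' (· + 2 * b₀ + p) fun _ hk => ?_⟩
      linear_combination hk
    · exact ⟨b₀, hb, hb₀⟩
  refine ⟨b, IsCoprime.mul_dvd ?_ (hd.add_odd hb.pow).two_dvd hpb⟩
  obtain ⟨r, hr⟩ := hodd
  exact ⟨-r, 1, by rw [hr]; ring⟩

theorem jacobiSym_eq_of_dvd_sub {a b : ℤ} {m : ℕ} (h : (m : ℤ) ∣ a - b) : J(a | m) = J(b | m) :=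
  jacobiSym.mod_left' (Int.emod_eq_emod_iff_emod_sub_eq_zero.2 (Int.emod_eq_zero_of_dvd h))

namespace TernaryForm

theorem isPos_mk {D n c d b k : ℤ} (hD : 0 < D) (hc : 0 < c) (hd : 0 < d) (hcd : c = d * n - D)
    (hk : d + b ^ 2 = c * k) :
    IsPos ⟨k, c, n, 0, 1, b⟩ ∧ det ⟨k, c, n, 0, 1, b⟩ = D := by
  have hdet : det ⟨k, c, n, 0, 1, b⟩ = D := by
    simp only [det]
    linear_combination -n * hk - hcd
  refine ⟨⟨?_, ?_, hdet ▸ hD⟩, hdet⟩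
  · exact pos_of_mul_pos_right (hk ▸ by positivity) hc.le
  · show 0 < k * c - b ^ 2
    linarith

end TernaryForm

open TernaryForm

theorem sum_three_squares_of_dvd {n c d b : ℤ} (hc : 0 < c) (hd : 0 < d) (hcd : c = d * n - 1)
    (hdvd : c ∣ d + b ^ 2) : ∃ x y z : ℤ, n = x ^ 2 + y ^ 2 + z ^ 2 := by
  obtain ⟨k, hk⟩ := hdvd
  obtain ⟨hpos, hdet⟩ := isPos_mk one_pos hc hd hcd hk
  exact sum_three_squares_of_det_eq_one hpos hdet ⟨0, 0, 1, by simp [eval]⟩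

theorem sum_three_squares_of_mod_four_eq_two {n : ℤ} (hn : 0 < n) (hmod : n % 4 = 2) :
    ∃ x y z : ℤ, n = x ^ 2 + y ^ 2 + z ^ 2 := by
  obtain ⟨j, rfl⟩ : ∃ j, n = 4 * j + 2 := ⟨n / 4, by omega⟩
  obtain ⟨p, k, hp, hpk⟩ := exists_prime_eq_add_mul (a := 4 * j + 1) (q := 4 * (4 * j + 2))
    (by positivity) (.mul_right ⟨1, -j, by ring⟩ ⟨-1, 1, by ring⟩)
  have hp₄ : p % 4 = 1 := by
    have : (p : ℤ) = 4 * (j + (4 * j + 2) * k) + 1 := by rw [hpk]; ring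
    omega
  have hpd : (p : ℤ) = ((4 * k + 1 : ℕ) : ℤ) * (4 * j + 2) - 1 := by rw [hpk]; push_cast; ring
  have hJ : J(-((4 * k + 1 : ℕ) : ℤ) | p) = 1 := by
    have hodd : Odd p := Nat.odd_iff.2 (by omega)
    rw [jacobiSym.neg _ hodd, χ₄_nat_one_mod_four hp₄, one_mul,
      jacobiSym.quadratic_reciprocity_one_mod_four (by omega) hodd,
      jacobiSym_eq_of_dvd_sub (b := -1) ⟨4 * j + 2, by rw [hpd]; ring⟩,
      jacobiSym.at_neg_one (Nat.odd_iff.2 (by omega)), χ₄_nat_one_mod_four (by omega)]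
  obtain ⟨b, hb⟩ := exists_dvd_add_sq_of_jacobiSym_neg hp hJ
  exact sum_three_squares_of_dvd (mod_cast hp.pos) (by positivity) hpd hb

theorem sum_three_squares_of_jacobiSym {n : ℤ} {p d : ℕ} (hp : p.Prime) (hp₂ : p % 2 = 1)
    (hd : d % 2 = 1) (hpd : 2 * (p : ℤ) = d * n - 1) (hJ : J(-(d : ℤ) | p) = 1) :
    ∃ x y z : ℤ, n = x ^ 2 + y ^ 2 + z ^ 2 := by
  obtain ⟨b, hb⟩ := exists_two_mul_dvd_add_sq hp (by exact_mod_cast Nat.odd_iff.2 hp₂)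
    (by exact_mod_cast Nat.odd_iff.2 hd) hJ
  have := hp.pos
  exact sum_three_squares_of_dvd (by positivity) (by omega) hpd hb

theorem jacobiSym_two_mul_jacobiSym {n : ℤ} {p d : ℕ} (hd : d % 2 = 1)
    (hpd : 2 * (p : ℤ) = d * n - 1) : χ₈ d * J(p | d) = χ₄ d := by
  have hodd : Odd d := Nat.odd_iff.2 hd
  rw [← jacobiSym.at_two hodd, ← jacobiSym.mul_left, ← jacobiSym.at_neg_one hodd]
  exact jacobiSym_eq_of_dvd_sub ⟨n, by rw [hpd]; ring⟩

theorem sum_three_squares_of_mod_four_eq_one {n : ℤ} (hn : 0 < n) (hmod : n % 4 = 1) :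
    ∃ x y z : ℤ, n = x ^ 2 + y ^ 2 + z ^ 2 := by
  obtain ⟨j, rfl⟩ : ∃ j, n = 4 * j + 1 := ⟨n / 4, by omega⟩
  obtain ⟨p, k, hp, hpk⟩ := exists_prime_eq_add_mul (a := 6 * j + 1) (q := 4 * (4 * j + 1))
    (by positivity) (.mul_right ⟨6 * j + 1, -(9 * j ^ 2 + 3 * j), by ring⟩ ⟨-2, 3, by ring⟩)
  have hp' : (p : ℤ) = 4 * ((4 * j + 1) * k + j) + 2 * j + 1 := by rw [hpk]; ring
  have hpd : 2 * (p : ℤ) = ((8 * k + 3 : ℕ) : ℤ) * (4 * j + 1) - 1 := by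
    rw [hpk]; push_cast; ring
  have hp₂ : p % 2 = 1 := by omega
  have hodd : Odd p := Nat.odd_iff.2 hp₂
  have hJ := jacobiSym_two_mul_jacobiSym (by omega) hpd
  rw [χ₄_nat_three_mod_four (by omega), χ₈_nat_mod_eight,
    show (8 * k + 3) % 8 = 3 by omega] at hJ
  replace hJ : J(p | 8 * k + 3) = 1 := by
    have : χ₈ ((3 : ℕ) : ZMod 8) = -1 := rfl
    rw [this] at hJ
    linarith
  refine sum_three_squares_of_jacobiSym hp hp₂ (by omega) hpd ?_
  rw [jacobiSym.neg _ hodd]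
  rcases Nat.odd_mod_four_iff.1 hp₂ with h | h
  · rw [χ₄_nat_one_mod_four h, jacobiSym.quadratic_reciprocity_one_mod_four'
      (Nat.odd_iff.2 (by omega)) h, hJ, one_mul]
  · rw [χ₄_nat_three_mod_four h, jacobiSym.quadratic_reciprocity_three_mod_four (by omega) h, hJ]
    rfl

theorem sum_three_squares_of_mod_eight_eq_three {n : ℤ} (hn : 0 < n) (hmod : n % 8 = 3) :
    ∃ x y z : ℤ, n = x ^ 2 + y ^ 2 + z ^ 2 := by
  obtain ⟨j, rfl⟩ : ∃ j, n = 8 * j + 3 := ⟨n / 8, by omega⟩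
  obtain ⟨p, k, hp, hpk⟩ := exists_prime_eq_add_mul (a := 4 * j + 1) (q := 4 * (8 * j + 3))
    (by positivity) (.mul_right ⟨1, -j, by ring⟩ ⟨-2, 1, by ring⟩)
  have hp₄ : p % 4 = 1 := by
    have : (p : ℤ) = 4 * ((8 * j + 3) * k + j) + 1 := by rw [hpk]; ring
    omega
  have hpd : 2 * (p : ℤ) = ((8 * k + 1 : ℕ) : ℤ) * (8 * j + 3) - 1 := by
    rw [hpk]; push_cast; ring
  have hodd : Odd p := Nat.odd_iff.2 (by omega)
  have hJ := jacobiSym_two_mul_jacobiSym (by omega) hpd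
  rw [χ₄_nat_one_mod_four (by omega), χ₈_nat_mod_eight,
    show (8 * k + 1) % 8 = 1 by omega, Nat.cast_one, map_one, one_mul] at hJ
  refine sum_three_squares_of_jacobiSym hp (by omega) (by omega) hpd ?_
  rw [jacobiSym.neg _ hodd, χ₄_nat_one_mod_four hp₄, one_mul,
    jacobiSym.quadratic_reciprocity_one_mod_four (by omega) hodd, hJ]

theorem exists_sq_add_of_mod_eight_eq_seven_of_not_dvd {n : ℤ} (hn : 0 < n) (hmod : n % 8 = 7)
    (h₁₁ : ¬ 11 ∣ n) : ∃ w y z : ℤ, n = w ^ 2 + 2 * y ^ 2 - 2 * y * z + 6 * z ^ 2 := by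
  obtain ⟨u, v, huv⟩ : IsCoprime n 11 :=
    ((Int.prime_iff_natAbs_prime.2 (by norm_num)).coprime_iff_not_dvd.2 h₁₁).symm
  have h₈ : IsCoprime (10 * n - 11) 8 := by
    obtain ⟨j, rfl⟩ : ∃ j, n = 8 * j + 7 := ⟨n / 8, by omega⟩
    exact ⟨3, -(30 * j + 22), by ring⟩
  obtain ⟨p, k, hp, hpk⟩ := exists_prime_eq_add_mul (a := 10 * n - 11) (q := 8 * 11 * n)
    (by positivity) (.mul_right (.mul_right h₈
      ⟨-u, 1 - 10 * v - u, by linear_combination (-10) * huv⟩)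
      ⟨-v, 10 * v + u, by linear_combination huv⟩)
  have hp₈ : p % 8 = 3 := by
    have : (p : ℤ) = 10 * n - 11 + 8 * (11 * n * k) := by rw [hpk]; ring
    omega
  have hpd : (p : ℤ) = (2 * ((44 * k + 5 : ℕ) : ℤ)) * n - 11 := by rw [hpk]; push_cast; ring
  have hJ : J(-(2 * ((44 * k + 5 : ℕ) : ℤ)) | p) = 1 := by
    have hodd : Odd p := Nat.odd_iff.2 (by omega)
    have hodd' : Odd (44 * k + 5) := Nat.odd_iff.2 (by omega)
    rw [← neg_mul, jacobiSym.mul_left, jacobiSym.at_neg_two hodd, χ₈'_nat_eq_if_mod_eight,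
      jacobiSym.quadratic_reciprocity_one_mod_four (by omega) hodd,
      jacobiSym_eq_of_dvd_sub (b := -11) ⟨2 * n, by rw [hpd]; ring⟩,
      jacobiSym.neg _ hodd', χ₄_nat_one_mod_four (by omega),
      show (11 : ℤ) = ((11 : ℕ) : ℤ) from rfl,
      ← jacobiSym.quadratic_reciprocity_one_mod_four (by omega) (by decide),
      jacobiSym_eq_of_dvd_sub (b := 5) ⟨4 * k, by push_cast; ring⟩,
      show J(5 | 11) = 1 by norm_num]
    simp [hp₈, show p % 2 = 1 by omega]
  obtain ⟨b, l, hl⟩ := exists_dvd_add_sq_of_jacobiSym_neg hp hJ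
  obtain ⟨hpos, hdet⟩ := isPos_mk (by norm_num) (mod_cast hp.pos) (by positivity) hpd hl
  refine exists_sq_add_of_det_eq_eleven hpos hdet ⟨0, 1, 1, 0, 0, 1, ?_, ?_⟩
    ⟨0, 0, 1, by simp [eval]⟩
  · refine ⟨(8 * k + 1) * n - 1, ?_⟩
    simp only [eval, hpd]
    push_cast
    ring
  · simpa [bilin] using h₁₁

theorem exists_sq_add_of_mod_eight_eq_seven_of_dvd {n : ℤ} (hn : 0 < n) (hmod : n % 8 = 7)
    (h₁₁ : 11 ∣ n) : ∃ w y z : ℤ, n = w ^ 2 + 2 * y ^ 2 - 2 * y * z + 6 * z ^ 2 := by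
  obtain ⟨m, rfl⟩ := h₁₁
  have hm : 0 < m := by omega
  have h₈ : IsCoprime (22 * m - 1) 8 := by
    obtain ⟨j, rfl⟩ : ∃ j, m = 8 * j + 5 := ⟨m / 8, by omega⟩
    exact ⟨5, -(110 * j + 68), by ring⟩
  obtain ⟨p, k, hp, hpk⟩ := exists_prime_eq_add_mul (a := 22 * m - 1) (q := 8 * 11 * m)
    (by positivity) (.mul_right (.mul_right h₈ ⟨-1, 2 * m, by ring⟩) ⟨-1, 22, by ring⟩)
  have hp₈ : p % 8 = 5 := by
    have : (p : ℤ) = 22 * m - 1 + 8 * (11 * m * k) := by rw [hpk]; ring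
    omega
  have hp₁₁ : (p : ℤ) = 11 * (2 * m * (4 * k + 1)) - 1 := by rw [hpk]; ring
  have hpd : (p : ℤ) = (22 * ((4 * k + 1 : ℕ) : ℤ)) * m - 1 := by rw [hpk]; push_cast; ring
  have hJ : J(-(22 * ((4 * k + 1 : ℕ) : ℤ)) | p) = 1 := by
    have hodd : Odd p := Nat.odd_iff.2 (by omega)
    have hodd' : Odd (4 * k + 1) := Nat.odd_iff.2 (by omega)
    rw [show -(22 * ((4 * k + 1 : ℕ) : ℤ)) = -2 * (11 : ℕ) * ((4 * k + 1 : ℕ) : ℤ) by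
        push_cast; ring,
      jacobiSym.mul_left, jacobiSym.mul_left, jacobiSym.at_neg_two hodd, χ₈'_nat_eq_if_mod_eight,
      jacobiSym.quadratic_reciprocity_one_mod_four' (a := 11) (by decide) (by omega),
      jacobiSym_eq_of_dvd_sub (a := p) (m := 11) (b := -1) ⟨2 * m * (4 * k + 1), by push_cast; rw [hp₁₁]; ring⟩,
      show J(-1 | 11) = -1 by norm_num,
      jacobiSym.quadratic_reciprocity_one_mod_four (a := 4 * k + 1) (by omega) hodd,
      jacobiSym_eq_of_dvd_sub (a := p) (b := -1) ⟨22 * m, by rw [hpd]; ring⟩,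
      jacobiSym.at_neg_one hodd', χ₄_nat_one_mod_four (by omega)]
    simp [hp₈, show p % 2 = 1 by omega]
  obtain ⟨b, hb⟩ := exists_dvd_add_sq_of_jacobiSym_neg hp hJ
  have hcop : IsCoprime (11 : ℤ) p := ⟨2 * m * (4 * k + 1), -1, by rw [hp₁₁]; ring⟩
  obtain ⟨β, hβ⟩ : ∃ β : ℤ, 11 * (p : ℤ) ∣ 22 * ((4 * k + 1 : ℕ) : ℤ) + (11 * β) ^ 2 := by
    obtain ⟨u, v, huv⟩ := hcop
    refine ⟨u * b, IsCoprime.mul_dvd ⟨u, v, huv⟩ ?_ (hb.imp'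
      (fun r => r + b ^ 2 * (p * v ^ 2 - 2 * v)) fun r hr => ?_)⟩
    · exact ⟨2 * ((4 * k + 1 : ℕ) : ℤ) + 11 * (u * b) ^ 2, by ring⟩
    · linear_combination hr + b ^ 2 * (11 * u + 1 - v * p) * huv
  obtain ⟨l, hl⟩ := hβ
  have := hp.pos
  obtain ⟨hpos, hdet⟩ := isPos_mk (D := 11) (n := 11 * m) (by norm_num) (by positivity)
    (by positivity) (by rw [hpd]; ring) hl
  exact exists_sq_add_of_det_eq_eleven hpos hdet
    ⟨0, 0, 1, 1, 0, 0, by simp [eval], by simp only [bilin]; norm_num⟩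
    ⟨0, 0, 1, by simp [eval]⟩

theorem exists_sq_add_of_mod_eight_eq_seven {n : ℤ} (hn : 0 < n) (hmod : n % 8 = 7) :
    ∃ w y z : ℤ, n = w ^ 2 + 2 * y ^ 2 - 2 * y * z + 6 * z ^ 2 := by
  by_cases h : 11 ∣ n
  · exact exists_sq_add_of_mod_eight_eq_seven_of_dvd hn hmod h
  · exact exists_sq_add_of_mod_eight_eq_seven_of_not_dvd hn hmod h

theorem sum_three_squares_mod_eight_ne_seven (x y z : ℤ) : (x ^ 2 + y ^ 2 + z ^ 2) % 8 ≠ 7 := by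
  have sq_mod (t : ℤ) : t ^ 2 % 8 = 0 ∨ t ^ 2 % 8 = 1 ∨ t ^ 2 % 8 = 4 := by
    have : t % 8 = 0 ∨ t % 8 = 1 ∨ t % 8 = 2 ∨ t % 8 = 3 ∨ t % 8 = 4 ∨ t % 8 = 5 ∨ t % 8 = 6 ∨
      t % 8 = 7 := by omega
    rcases this with h | h | h | h | h | h | h | h <;> simp [pow_two, Int.mul_emod, h]
  have := sq_mod x
  have := sq_mod y
  have := sq_mod z
  omega

theorem sum_three_squares_or_sum_four_squares (n : ℕ) (hn : 0 < n) :
    (∃ x y z : ℤ, (n : ℤ) = x ^ 2 + y ^ 2 + z ^ 2) ∨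
      ∃ w x y z : ℤ, w ≠ 0 ∧ (n : ℤ) = w ^ 2 + x ^ 2 + y ^ 2 + z ^ 2 ∧ x + y = 3 * z := by
  induction n using Nat.strong_induction_on with
  | _ n ih =>
  have hn' : (0 : ℤ) < n := mod_cast hn
  by_cases h₄ : 4 ∣ n
  · obtain ⟨m, rfl⟩ := h₄
    rcases ih m (by omega) (by omega) with ⟨x, y, z, h⟩ | ⟨w, x, y, z, hw, h, hz⟩
    · exact .inl ⟨2 * x, 2 * y, 2 * z, by push_cast; rw [h]; ring⟩
    · exact .inr ⟨2 * w, 2 * x, 2 * y, 2 * z, by simpa, by push_cast; rw [h]; ring,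
        by linear_combination 2 * hz⟩
  by_cases h₇ : n % 8 = 7
  · obtain ⟨w, y, z, h⟩ := exists_sq_add_of_mod_eight_eq_seven hn' (by omega)
    have h' : (n : ℤ) = w ^ 2 + (y + z) ^ 2 + (2 * z - y) ^ 2 + z ^ 2 := by rw [h]; ring
    refine .inr ⟨w, y + z, 2 * z - y, z, ?_, h', by ring⟩
    rintro rfl
    apply sum_three_squares_mod_eight_ne_seven (y + z) (2 * z - y) z
    rw [show (y + z) ^ 2 + (2 * z - y) ^ 2 + z ^ 2 = (n : ℤ) by rw [h']; ring]
    omega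
  · left
    obtain h | h | h : n % 4 = 2 ∨ n % 4 = 1 ∨ n % 8 = 3 := by omega
    · exact sum_three_squares_of_mod_four_eq_two hn' (by omega)
    · exact sum_three_squares_of_mod_four_eq_one hn' (by omega)
    · exact sum_three_squares_of_mod_eight_eq_three hn' (by omega)

theorem exists_ne_zero_sum_three_squares {n x y z : ℤ} (hn : n ≠ 0)
    (h : n = x ^ 2 + y ^ 2 + z ^ 2) : ∃ w x y : ℤ, w ≠ 0 ∧ n = w ^ 2 + x ^ 2 + y ^ 2 := by
  by_cases hx : x = 0
  · by_cases hy : y = 0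
    · refine ⟨z, x, y, ?_, by rw [h]; ring⟩
      rintro rfl
      simp [hx, hy] at h
      exact hn h
    · exact ⟨y, x, z, hy, by rw [h]; ring⟩
  · exact ⟨x, y, z, hx, h⟩

theorem stmt_12 (n : ℕ) (hn : 0 < n) :
    (∃ w x y z : ℤ, w ≠ 0 ∧ (n : ℤ) = w ^ 2 + x ^ 2 + y ^ 2 + z ^ 2 ∧
        ∃ t : ℤ, x ^ 2 * y ^ 2 + 9 * y ^ 2 * z ^ 2 + 9 * z ^ 2 * x ^ 2 = t ^ 2) ∧
    (∃ w x y z : ℤ, w ≠ 0 ∧ (n : ℤ) = w ^ 2 + x ^ 2 + y ^ 2 + z ^ 2 ∧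
        ∃ t : ℤ, x ^ 2 + 12 * y * z = t ^ 2) ∧
    (∃ w x y z : ℤ, w ≠ 0 ∧ (n : ℤ) = w ^ 2 + x ^ 2 + y ^ 2 + z ^ 2 ∧
        ∃ t : ℤ, 9 * x ^ 2 - 4 * y * z = t ^ 2) ∧
    (∃ w x y z : ℤ, w ≠ 0 ∧ (n : ℤ) = w ^ 2 + x ^ 2 + y ^ 2 + z ^ 2 ∧
        ∃ t : ℤ, (x + 3 * y) * z = t ^ 2) := by
  rcases sum_three_squares_or_sum_four_squares n hn with ⟨x, y, z, h⟩ | ⟨w, x, y, z, hw, h, hz⟩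
  · obtain ⟨w, x, y, hw, h⟩ := exists_ne_zero_sum_three_squares (by omega) h
    refine ⟨⟨w, x, 0, y, hw, ?_, 3 * y * x, ?_⟩, ⟨w, x, 0, y, hw, ?_, x, ?_⟩,
      ⟨w, x, 0, y, hw, ?_, 3 * x, ?_⟩, ⟨w, x, y, 0, hw, ?_, 0, ?_⟩⟩ <;>
    first | linear_combination h | ring
  · obtain rfl : x = 3 * z - y := by linarith
    refine ⟨⟨w, 3 * z - y, y, z, hw, ?_, y ^ 2 - 3 * y * z + 9 * z ^ 2, ?_⟩,
      ⟨w, y - 3 * z, y, z, hw, ?_, y + 3 * z, ?_⟩,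
      ⟨w, z, 3 * z - y, y, hw, ?_, 3 * z - 2 * y, ?_⟩,
      ⟨w, y - 3 * z, z, y, hw, ?_, y, ?_⟩⟩ <;>
    first | linear_combination h | ring
end
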